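/- Let sigma be a weight of K with dim sigma > 1. If the image of f_1 in (ind_K^G sigma)/(T) generates (ind_K^G sigma)/(T) as a representation of G, then f_1 generates ind_K^G sigma as a representation of G. -/

import Mathlib

open scoped Classical

noncomputable section

namespace U21

/-- The arithmetic setting: `E` is the unramified quadratic extension of a non-archimedean
local field `F` of odd residue characteristic `p`, with residue field of `F` of cardinality
`q = p ^ fdeg`.  The field `E` is encoded through its valuation subring `O = o_E`, a
uniformizer `ϖ`, the maximal ideal `mI` (so that `p_E^k` is `ϖ ^ k * O`), and the nontrivial
`F`-automorphism `conj` of `E` (which induces the `q`-power Frobenius on the residue field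
of `E`, of cardinality `q ^ 2`). -/
structure Setting where
  p : ℕ
  q : ℕ
  fdeg : ℕ
  hp : p.Prime
  hodd : p ≠ 2
  hfdeg : 0 < fdeg
  hq : q = p ^ fdeg
  E : Type
  [fieldE : Field E]
  conj : E →+* E
  conj_invol : ∀ x, conj (conj x) = x
  conj_ne : conj ≠ RingHom.id E
  O : Subring E
  val_ring : ∀ x : E, x ≠ 0 → x ∈ O ∨ x⁻¹ ∈ O
  conj_O : ∀ x, x ∈ O → conj x ∈ O
  ϖ : E
  unif_mem : ϖ ∈ O
  unif_ne : ϖ ≠ 0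
  unif_conj : conj ϖ = ϖ
  unif_not_unit : ¬ IsUnit (⟨ϖ, unif_mem⟩ : O)
  disc : ∀ x : E, x ≠ 0 → ∃ (n : ℤ) (u : Oˣ), x = (u : O) * ϖ ^ n
  mI : Ideal O
  hmI : ∀ x : O, x ∈ mI ↔ ∃ y ∈ O, (x : E) = ϖ * y
  [fin_res : Fintype (O ⧸ mI)]
  card_res : Fintype.card (O ⧸ mI) = q ^ 2
  res_frob : ∀ x : O, Ideal.Quotient.mk mI ⟨conj x, conj_O x x.2⟩ = (Ideal.Quotient.mk mI x) ^ q
  complete : ∀ a : ℕ → E,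
    (∀ k : ℕ, ∃ N, ∀ m ≥ N, ∀ n ≥ N, ∃ w ∈ O, a m - a n = ϖ ^ k * w) →
    ∃ L : E, ∀ k : ℕ, ∃ N, ∀ n ≥ N, ∃ w ∈ O, a n - L = ϖ ^ k * w

attribute [instance] Setting.fieldE Setting.fin_res

namespace Setting

variable (S : Setting)

/-- 3×3 matrices over `E`. -/
abbrev M3 := Matrix (Fin 3) (Fin 3) S.E

/-- The antidiagonal matrix `β` of the Hermitian form. -/
def betaM : S.M3 := !![0,0,1;0,1,0;1,0,0]

/-- The fractional ideal `p_E ^ k ⊆ E` (for `k : ℤ`). -/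
def pE (k : ℤ) : Set S.E := {z | ∃ w ∈ S.O, z = S.ϖ ^ k * w}

/-- The unramified unitary group `G = U(2,1)(E/F)`, as a subgroup of `GL₃(E)`:
`g ∈ G` iff `g.transpose * β * conj g = β`. -/
def Gsub : Subgroup (Matrix.GeneralLinearGroup (Fin 3) S.E) where
  carrier := {g | ((g : S.M3)).transpose * S.betaM * ((g : S.M3).map S.conj) = S.betaM}
  one_mem' := by
    simp [Matrix.map_one (⇑S.conj) (map_zero S.conj) (map_one S.conj)]
  mul_mem' := by
    intro a b ha hb
    simp only [Set.mem_setOf_eq, Units.val_mul, Matrix.transpose_mul, Matrix.map_mul] at ha hb ⊢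
    calc ((b : S.M3)).transpose * ((a : S.M3)).transpose * S.betaM * ((a : S.M3).map S.conj * (b : S.M3).map S.conj)
        = ((b : S.M3)).transpose * (((a : S.M3)).transpose * S.betaM * (a : S.M3).map S.conj) * ((b : S.M3).map S.conj) := by
          simp only [mul_assoc]
      _ = S.betaM := by rw [ha]; exact hb
  inv_mem' := by
    intro a ha
    simp only [Set.mem_setOf_eq] at ha ⊢
    have hA : IsUnit ((a : S.M3)) := a.isUnit
    have hdet : IsUnit ((a : S.M3)).det := (Matrix.isUnit_iff_isUnit_det _).mp hA
    have hAc : IsUnit (((a : S.M3)).map ⇑S.conj) := by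
      rw [← RingHom.mapMatrix_apply]; exact hA.map _
    have hdetc : IsUnit ((((a : S.M3)).map ⇑S.conj).det) := (Matrix.isUnit_iff_isUnit_det _).mp hAc
    have hdetT : IsUnit ((((a : S.M3)).transpose).det) := by rw [Matrix.det_transpose]; exact hdet
    have hmapinv : ((a : S.M3)⁻¹).map ⇑S.conj = (((a : S.M3)).map ⇑S.conj)⁻¹ := by
      symm
      apply Matrix.inv_eq_left_inv
      rw [← Matrix.map_mul, Matrix.nonsing_inv_mul _ hdet,
        Matrix.map_one (⇑S.conj) (map_zero S.conj) (map_one S.conj)]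
    rw [Matrix.coe_units_inv, Matrix.transpose_nonsing_inv, hmapinv]
    conv_lhs => rw [← ha]
    calc (((a:S.M3)).transpose)⁻¹ * (((a:S.M3)).transpose * S.betaM * ((a:S.M3)).map ⇑S.conj) * (((a:S.M3)).map ⇑S.conj)⁻¹
        = (((a:S.M3)).transpose)⁻¹ * ((a:S.M3)).transpose * S.betaM *
            (((a:S.M3)).map ⇑S.conj * (((a:S.M3)).map ⇑S.conj)⁻¹) := by simp only [mul_assoc]
      _ = S.betaM := by
          rw [Matrix.nonsing_inv_mul _ hdetT, Matrix.mul_nonsing_inv _ hdetc, one_mul, mul_one]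

/-- The group `G = U(2,1)(E/F)`. -/
abbrev GG := ↥S.Gsub

/-- The matrix of an element of `G`. -/
def mat (g : S.GG) : S.M3 := ((g : Matrix.GeneralLinearGroup (Fin 3) S.E) : S.M3)

/-- The upper unipotent matrix `n(x,y)`. -/
def nM (x y : S.E) : S.M3 := !![1, x, y; 0, 1, -S.conj x; 0, 0, 1]

/-- The lower unipotent matrix `n'(x,y)`. -/
def n'M (x y : S.E) : S.M3 := !![1, 0, 0; x, 1, 0; y, -S.conj x, 1]

/-- The diagonal matrix `h(x) = diag(x, -x̄x⁻¹, x̄⁻¹)`. -/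
def hM (x : S.E) : S.M3 := !![x, 0, 0; 0, -S.conj x * x⁻¹, 0; 0, 0, (S.conj x)⁻¹]

/-- The subgroup `N` of `G` (unipotent radical of the upper triangular Borel), as a set. -/
def Nset : Set S.GG := {g | ∃ x y : S.E, x * S.conj x + y + S.conj y = 0 ∧ S.mat g = S.nM x y}

/-- The subgroup `N_k = {n(x,y) : y ∈ p_E^k}`, as a set. -/
def Nk (k : ℤ) : Set S.GG :=
  {g | ∃ x y : S.E, x * S.conj x + y + S.conj y = 0 ∧ y ∈ S.pE k ∧ S.mat g = S.nM x y}

/-- The subgroup `N'` of `G`, as a set. -/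
def N'set : Set S.GG := {g | ∃ x y : S.E, x * S.conj x + y + S.conj y = 0 ∧ S.mat g = S.n'M x y}

/-- The subgroup `N'_k = {n'(x,y) : y ∈ p_E^k}`, as a set. -/
def N'k (k : ℤ) : Set S.GG :=
  {g | ∃ x y : S.E, x * S.conj x + y + S.conj y = 0 ∧ y ∈ S.pE k ∧ S.mat g = S.n'M x y}

/-- The diagonal subgroup `H` of `G`, as a set. -/
def Hset : Set S.GG := {g | ∃ a b c : S.E, S.mat g = !![a,0,0;0,b,0;0,0,c]}

/-- The hyperspecial maximal compact subgroup `K₀ = G ∩ GL₃(o_E)`, as a set. -/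
def K0set : Set S.GG := {g | ∀ i j, S.mat g i j ∈ S.O}

/-- The special (non-hyperspecial) maximal compact subgroup `K₁`, as a set. -/
def K1set : Set S.GG :=
  {g | S.mat g 0 0 ∈ S.O ∧ S.mat g 0 1 ∈ S.O ∧ S.mat g 0 2 ∈ S.pE (-1) ∧
       S.mat g 1 0 ∈ S.pE 1 ∧ S.mat g 1 1 ∈ S.O ∧ S.mat g 1 2 ∈ S.O ∧
       S.mat g 2 0 ∈ S.pE 1 ∧ S.mat g 2 1 ∈ S.pE 1 ∧ S.mat g 2 2 ∈ S.O}

/-- The Iwahori subgroup `I_{K₀}` (preimage of the Borel of `Γ_{K₀}`), as a set. -/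
def IK0 : Set S.GG :=
  {g | g ∈ S.K0set ∧ S.mat g 1 0 ∈ S.pE 1 ∧ S.mat g 2 0 ∈ S.pE 1 ∧ S.mat g 2 1 ∈ S.pE 1}

/-- The pro-p Iwahori subgroup `I_{1,K₀}`, as a set. -/
def I1K0 : Set S.GG :=
  {g | g ∈ S.IK0 ∧ S.mat g 0 0 - 1 ∈ S.pE 1 ∧ S.mat g 1 1 - 1 ∈ S.pE 1 ∧ S.mat g 2 2 - 1 ∈ S.pE 1}

/-- The opposite pro-p Iwahori subgroup `I'_{1,K₀}`, as a set. -/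
def I1'K0 : Set S.GG :=
  {g | g ∈ S.K0set ∧ S.mat g 0 1 ∈ S.pE 1 ∧ S.mat g 0 2 ∈ S.pE 1 ∧ S.mat g 1 2 ∈ S.pE 1 ∧
       S.mat g 0 0 - 1 ∈ S.pE 1 ∧ S.mat g 1 1 - 1 ∈ S.pE 1 ∧ S.mat g 2 2 - 1 ∈ S.pE 1}

/-- The maximal normal pro-p subgroup `K₀¹` of `K₀` (principal congruence subgroup), as a set. -/
def Kone0 : Set S.GG := {g | ∀ i j, S.mat g i j - (1 : S.M3) i j ∈ S.pE 1}

/-- The Iwahori subgroup `I_{K₁}`, as a set. -/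
def IK1 : Set S.GG := {g | g ∈ S.K1set ∧ S.mat g 2 0 ∈ S.pE 2}

/-- The pro-p Iwahori subgroup `I_{1,K₁}`, as a set. -/
def I1K1 : Set S.GG :=
  {g | g ∈ S.IK1 ∧ S.mat g 0 0 - 1 ∈ S.pE 1 ∧ S.mat g 1 1 - 1 ∈ S.pE 1 ∧ S.mat g 2 2 - 1 ∈ S.pE 1}

/-- The opposite pro-p Iwahori subgroup `I'_{1,K₁}`, as a set. -/
def I1'K1 : Set S.GG :=
  {g | g ∈ S.K1set ∧ S.mat g 0 2 ∈ S.O ∧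
       S.mat g 0 0 - 1 ∈ S.pE 1 ∧ S.mat g 1 1 - 1 ∈ S.pE 1 ∧ S.mat g 2 2 - 1 ∈ S.pE 1}

/-- The maximal normal pro-p subgroup `K₁¹` of `K₁`, as a set. -/
def Kone1 : Set S.GG :=
  {g | g ∈ S.K1set ∧ S.mat g 0 2 ∈ S.O ∧ S.mat g 2 0 ∈ S.pE 2 ∧
       S.mat g 0 0 - 1 ∈ S.pE 1 ∧ S.mat g 1 1 - 1 ∈ S.pE 1 ∧ S.mat g 2 2 - 1 ∈ S.pE 1}

/-- The congruence subgroup of level `n` (used to express smoothness), as a set. -/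
def cong (n : ℕ) : Set S.GG := {g | ∀ i j, S.mat g i j - (1 : S.M3) i j ∈ S.pE n}

def alphaM : S.M3 := !![S.ϖ⁻¹, 0, 0; 0, 1, 0; 0, 0, S.ϖ]

def alphaMinv : S.M3 := !![S.ϖ, 0, 0; 0, 1, 0; 0, 0, S.ϖ⁻¹]

lemma alpha_mul_inv : S.alphaM * S.alphaMinv = 1 := by
  ext i j
  fin_cases i <;> fin_cases j <;>
    simp [alphaM, alphaMinv, Matrix.mul_apply, Fin.sum_univ_three, Matrix.one_apply,
      Matrix.vecHead, Matrix.vecTail, inv_mul_cancel₀ S.unif_ne, mul_inv_cancel₀ S.unif_ne]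

lemma alpha_inv_mul : S.alphaMinv * S.alphaM = 1 := by
  ext i j
  fin_cases i <;> fin_cases j <;>
    simp [alphaM, alphaMinv, Matrix.mul_apply, Fin.sum_univ_three, Matrix.one_apply,
      Matrix.vecHead, Matrix.vecTail, inv_mul_cancel₀ S.unif_ne, mul_inv_cancel₀ S.unif_ne]

def alphaU : Matrix.GeneralLinearGroup (Fin 3) S.E :=
  ⟨S.alphaM, S.alphaMinv, S.alpha_mul_inv, S.alpha_inv_mul⟩

lemma alphaU_mem : S.alphaU ∈ S.Gsub := by
  show ((S.alphaU : S.M3)).transpose * S.betaM * ((S.alphaU : S.M3).map S.conj) = S.betaM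
  have : (S.alphaU : S.M3) = S.alphaM := rfl
  rw [this]
  ext i j
  fin_cases i <;> fin_cases j <;>
    simp [alphaM, betaM, Matrix.mul_apply, Fin.sum_univ_three, Matrix.map_apply,
      Matrix.transpose_apply, Matrix.vecHead, Matrix.vecTail, map_inv₀, S.unif_conj,
      inv_mul_cancel₀ S.unif_ne, mul_inv_cancel₀ S.unif_ne]

/-- The element `α = diag(ϖ⁻¹, 1, ϖ)` of `G`. -/
def alphaE : S.GG := ⟨S.alphaU, S.alphaU_mem⟩

lemma beta_mul_beta : S.betaM * S.betaM = 1 := by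
  ext i j
  fin_cases i <;> fin_cases j <;>
    simp [betaM, Matrix.mul_apply, Fin.sum_univ_three, Matrix.one_apply,
      Matrix.vecHead, Matrix.vecTail]

def betaU : Matrix.GeneralLinearGroup (Fin 3) S.E :=
  ⟨S.betaM, S.betaM, S.beta_mul_beta, S.beta_mul_beta⟩

lemma betaU_mem : S.betaU ∈ S.Gsub := by
  show ((S.betaU : S.M3)).transpose * S.betaM * ((S.betaU : S.M3).map S.conj) = S.betaM
  have : (S.betaU : S.M3) = S.betaM := rfl
  rw [this]
  ext i j
  fin_cases i <;> fin_cases j <;>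
    simp [betaM, Matrix.mul_apply, Fin.sum_univ_three, Matrix.map_apply, Matrix.transpose_apply,
      Matrix.vecHead, Matrix.vecTail]

/-- The element `β` of `G`. -/
def betaE : S.GG := ⟨S.betaU, S.betaU_mem⟩

/-- The element `β' = β * α⁻¹` of `G`. -/
def betaPr : S.GG := S.betaE * S.alphaE⁻¹

/-- A finite set `U` is a set of representatives for the cosets `A/B`. -/
def IsReps (A B : Set S.GG) (U : Finset S.GG) : Prop :=
  (↑U : Set S.GG) ⊆ A ∧ ∀ a ∈ A, ∃! u, u ∈ U ∧ a⁻¹ * u ∈ B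

/-- The residue field `k_E` of `E`. -/
abbrev kE := S.O ⧸ S.mI

/-- The residue map `o_E → k_E`. -/
def resmap : S.O →+* S.kE := Ideal.Quotient.mk S.mI

/-- The group `L_{q³} = {(x,t) ∈ k_E² : x x̄ + t + t̄ = 0}` (where `x̄ = x^q`). -/
def Lbig : Set (S.kE × S.kE) := {z | z.1 * z.1 ^ S.q + z.2 + z.2 ^ S.q = 0}

/-- The group `L_q = {(0,t) ∈ k_E² : t + t̄ = 0}`. -/
def Lsmall : Set (S.kE × S.kE) := {z | z.1 = 0 ∧ z.2 + z.2 ^ S.q = 0}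

/-- `L_{q^t}` for `t ∈ {1,3}`. -/
def Lof (t : ℕ) : Set (S.kE × S.kE) := if t = 3 then S.Lbig else S.Lsmall

end Setting

/-- A choice of one of the two maximal compact open subgroups `K ∈ {K₀, K₁}` of `G`,
together with its maximal normal pro-p subgroup `K¹`, the (pro-p) Iwahori subgroups
`I_K ⊇ I_{1,K}`, the opposite pro-p Iwahori `I'_{1,K}`, the element
`β_K ∈ K ∩ {β, β'}`, and the integers `n_K, m_K, t_K`. -/
structure Chamber (S : Setting) where
  K : Subgroup S.GG
  KoneS : Set S.GG
  IK : Set S.GG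
  I1 : Set S.GG
  I1' : Set S.GG
  βK : S.GG
  nK : ℤ
  mK : ℤ
  tK : ℕ
  cases :
    ((K : Set S.GG) = S.K0set ∧ KoneS = S.Kone0 ∧ IK = S.IK0 ∧ I1 = S.I1K0 ∧ I1' = S.I1'K0 ∧
      βK = S.betaE ∧ nK = 0 ∧ mK = 1 ∧ tK = 3) ∨
    ((K : Set S.GG) = S.K1set ∧ KoneS = S.Kone1 ∧ IK = S.IK1 ∧ I1 = S.I1K1 ∧ I1' = S.I1'K1 ∧
      βK = S.betaPr ∧ nK = -1 ∧ mK = 2 ∧ tK = 1)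

namespace Chamber

variable {S : Setting} (C : Chamber S)

/-- `H₀ = H ∩ I_K`. -/
def H0 : Set S.GG := S.Hset ∩ C.IK

/-- `H₁ = H ∩ I_{1,K}`. -/
def H1 : Set S.GG := S.Hset ∩ C.I1

end Chamber

section RepTheory

variable {S : Setting} (C : Chamber S)
variable (𝔽 : Type) [Field 𝔽]

section Generic

variable {G₀ : Type} [Monoid G₀] {V : Type} [AddCommGroup V] [Module 𝔽 V]

/-- A submodule is invariant under a representation. -/
def Invt (ρ : Representation 𝔽 G₀ V) (Ssub : Submodule 𝔽 V) : Prop :=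
  ∀ g v, v ∈ Ssub → ρ g v ∈ Ssub

/-- The subrepresentation generated by a vector (the span of its orbit). -/
def orbitSpan (ρ : Representation 𝔽 G₀ V) (v : V) : Submodule 𝔽 V :=
  Submodule.span 𝔽 {w | ∃ g, w = ρ g v}

/-- The subrepresentation generated by a vector under a subset `A` of the group. -/
def orbitSpanOn (ρ : Representation 𝔽 G₀ V) (A : Set G₀) (v : V) : Submodule 𝔽 V :=
  Submodule.span 𝔽 {w | ∃ g ∈ A, w = ρ g v}

/-- The quotient of a representation by an invariant submodule `N` is irreducible:
equivalently (by the lattice correspondence), `N ≠ ⊤` and any invariant submodule lying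
between `N` and `⊤` equals `N` or `⊤`. -/
def QuotientIrreducible (ρ : Representation 𝔽 G₀ V) (N : Submodule 𝔽 V) : Prop :=
  N ≠ ⊤ ∧ ∀ Ssub : Submodule 𝔽 V, Invt 𝔽 ρ Ssub → N ≤ Ssub → Ssub = N ∨ Ssub = ⊤

/-- The submodule of vectors invariant under all elements of the subset `A`. -/
def invariantsOn (ρ : Representation 𝔽 G₀ V) (A : Set G₀) : Submodule 𝔽 V where
  carrier := {v | ∀ g ∈ A, ρ g v = v}
  add_mem' := by
    intro a b ha hb g hg
    rw [map_add, ha g hg, hb g hg]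
  zero_mem' := by
    intro g hg
    rw [map_zero]
  smul_mem' := by
    intro c a ha g hg
    rw [map_smul, ha g hg]

/-- The space `Hom_G(ρ₁, ρ₂)` of equivariant linear maps, as a submodule of the linear maps. -/
def EquivHomSub {V₂ : Type} [AddCommGroup V₂] [Module 𝔽 V₂]
    (ρ₁ : Representation 𝔽 G₀ V) (ρ₂ : Representation 𝔽 G₀ V₂) :
    Submodule 𝔽 (V →ₗ[𝔽] V₂) where
  carrier := {φ | ∀ g x, φ (ρ₁ g x) = ρ₂ g (φ x)}
  add_mem' := by
    intro a b ha hb g x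
    simp only [LinearMap.add_apply, ha g x, hb g x, map_add]
  zero_mem' := by
    intro g x
    simp only [LinearMap.zero_apply, map_zero]
  smul_mem' := by
    intro c a ha g x
    simp only [LinearMap.smul_apply, ha g x, map_smul]

end Generic

section Weight

variable (W : Type) [AddCommGroup W] [Module 𝔽 W]
variable (σ : Representation 𝔽 ↥C.K W)

/-- Extension of `σ` to all of `G` (by `1` outside `K`); used to avoid coercion issues. -/
def sigma' : S.GG → Module.End 𝔽 W := fun g => if h : g ∈ C.K then σ ⟨g, h⟩ else 1

/-- `σ` is a weight of `K`: an irreducible smooth representation of `K` over `𝔽`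
factoring through `Γ_K = K / K¹` (automatically finite dimensional). -/
def IsWeight : Prop :=
  Nontrivial W ∧ FiniteDimensional 𝔽 W ∧
  (∀ Ssub : Submodule 𝔽 W, (∀ (k : ↥C.K) (w : W), w ∈ Ssub → σ k w ∈ Ssub) → Ssub = ⊥ ∨ Ssub = ⊤) ∧
  (∀ (g : S.GG) (hg : g ∈ C.K), g ∈ C.KoneS → σ ⟨g, hg⟩ = LinearMap.id)

/-- `σ` is one dimensional of the form `χ ∘ det`. -/
def IsDetWeight : Prop :=
  Module.finrank 𝔽 W = 1 ∧
  ∃ c : S.E → 𝔽, ∀ (g : S.GG) (hg : g ∈ C.K) (w : W), σ ⟨g, hg⟩ w = c ((S.mat g).det) • w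

/-- `j_σ : σ → σ` is the composition of the coinvariant projection `σ → σ_{I'_{1,K}}`
with the inverse of the natural isomorphism `σ^{I_{1,K}} ≅ σ_{I'_{1,K}}`:
it restricts to the identity on `σ^{I_{1,K}}` and kills the augmentation part of
`σ` with respect to `I'_{1,K}`. -/
def IsJ (jσ : W →ₗ[𝔽] W) : Prop :=
  (∀ w : W, (∀ g ∈ C.I1, sigma' C 𝔽 W σ g w = w) → jσ w = w) ∧
  (∀ (w : W) (g : S.GG), g ∈ C.I1' → jσ (sigma' C 𝔽 W σ g w - w) = 0)

/-- The defining conditions of the compact induction `ind_K^G σ`: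
`K`-equivariance on the left and compact support (finitely many cosets `K g`). -/
def IndCarrier : Set (S.GG → W) :=
  {f | (∀ (k : S.GG) (hk : k ∈ C.K) (g : S.GG), f (k * g) = σ ⟨k, hk⟩ (f g)) ∧
       ∃ s : Finset S.GG, ∀ g : S.GG, f g ≠ 0 → ∃ k ∈ C.K, ∃ t ∈ s, g = k * t}

/-- The compact induction `ind_K^G σ`, as a submodule of `G → W`. -/
def IndSub : Submodule 𝔽 (S.GG → W) where
  carrier := IndCarrier C 𝔽 W σ
  add_mem' := by
    rintro f g ⟨hf1, sf, hf2⟩ ⟨hg1, sg, hg2⟩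
    refine ⟨fun k hk x => by simp [hf1 k hk x, hg1 k hk x], sf ∪ sg, fun x hx => ?_⟩
    by_cases h : f x ≠ 0
    · obtain ⟨k, hk, t, ht, rfl⟩ := hf2 x h
      exact ⟨k, hk, t, Finset.mem_union_left _ ht, rfl⟩
    · push_neg at h
      have hgx : g x ≠ 0 := by
        intro h0
        apply hx
        simp [Pi.add_apply, h, h0]
      obtain ⟨k, hk, t, ht, rfl⟩ := hg2 x hgx
      exact ⟨k, hk, t, Finset.mem_union_right _ ht, rfl⟩
  zero_mem' := ⟨fun k hk g => by simp, ∅, fun g hg => absurd rfl hg⟩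
  smul_mem' := by
    rintro c f ⟨hf1, sf, hf2⟩
    refine ⟨fun k hk g => by simp [hf1 k hk g], sf, fun x hx => ?_⟩
    refine hf2 x ?_
    intro h0
    apply hx
    simp [h0]

lemma indAct_mem (g : S.GG) {f : S.GG → W} (hf : f ∈ IndCarrier C 𝔽 W σ) :
    (fun x => f (x * g)) ∈ IndCarrier C 𝔽 W σ := by
  obtain ⟨h1, s, h2⟩ := hf
  refine ⟨fun k hk x => ?_, s.image (· * g⁻¹), ?_⟩
  · show f (k * x * g) = _
    rw [mul_assoc]
    exact h1 k hk (x * g)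
  intro x hx
  obtain ⟨k, hk, t, ht, hxg⟩ := h2 (x * g) hx
  refine ⟨k, hk, t * g⁻¹, Finset.mem_image_of_mem _ ht, ?_⟩
  rw [← mul_assoc, ← hxg, mul_assoc, mul_inv_cancel, mul_one]

/-- The representation of `G` on `ind_K^G σ` by right translation. -/
def indRep : Representation 𝔽 S.GG ↥(IndSub C 𝔽 W σ) where
  toFun g :=
    { toFun := fun f => ⟨fun x => (f : S.GG → W) (x * g), indAct_mem C 𝔽 W σ g f.2⟩
      map_add' := fun f1 f2 => Subtype.ext (funext fun x => rfl)
      map_smul' := fun c f => Subtype.ext (funext fun x => rfl) }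
  map_one' := LinearMap.ext fun f => Subtype.ext (funext fun x => by simp [mul_one])
  map_mul' g h := LinearMap.ext fun f => Subtype.ext (funext fun x => by simp [mul_assoc])

/-- The function `[g, v] ∈ ind_K^G σ`: supported on `K g⁻¹`, with value `v` at `g⁻¹`. -/
def stdFn (g : S.GG) (v : W) : S.GG → W :=
  fun x => if h : x * g ∈ C.K then σ ⟨x * g, h⟩ v else 0

/-- The characterization of the family `f_n` (`n ∈ ℤ`) of `I_{1,K}`-invariant elements of
`ind_K^G σ`: `f_n` is supported on `K α⁻ⁿ I_{1,K}` and has value at `α⁻ⁿ` equal to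
`σ(β_K) v₀` for `n > 0` and `v₀` for `n ≤ 0`, where `v₀` is a fixed nonzero vector of
`σ^{I_{1,K}}`. -/
def IsFFamily (v0 : W) (ff : ℤ → ↥(IndSub C 𝔽 W σ)) : Prop :=
  v0 ≠ 0 ∧ (∀ g ∈ C.I1, sigma' C 𝔽 W σ g v0 = v0) ∧
  (∀ (n : ℤ) (g : S.GG), g ∈ C.I1 → indRep C 𝔽 W σ g (ff n) = ff n) ∧
  (∀ (n : ℤ) (x : S.GG), (ff n : S.GG → W) x ≠ 0 →
    ∃ k ∈ C.K, ∃ i ∈ C.I1, x = k * S.alphaE ^ (-n) * i) ∧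
  (∀ n : ℤ, 0 < n → (ff n : S.GG → W) (S.alphaE ^ (-n)) = sigma' C 𝔽 W σ C.βK v0) ∧
  (∀ n : ℤ, n ≤ 0 → (ff n : S.GG → W) (S.alphaE ^ (-n)) = v0)

/-- The characterization of the Hecke operator `T ∈ End_G(ind_K^G σ)`:
it is `G`-equivariant and satisfies
`T [1, v] = ∑_{u ∈ N_{n_K}/N_{n_K+2}} [u α⁻¹, j_σ σ(u⁻¹) v]
  + ∑_{u ∈ N_{n_K+1}/N_{n_K+2}} [β_K u α⁻¹, j_σ σ(β_K) v]`. -/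
def IsHeckeT (jσ : W →ₗ[𝔽] W) (T : Module.End 𝔽 ↥(IndSub C 𝔽 W σ)) : Prop :=
  (∀ (g : S.GG) (x : ↥(IndSub C 𝔽 W σ)),
    T (indRep C 𝔽 W σ g x) = indRep C 𝔽 W σ g (T x)) ∧
  (∀ (v : W) (x : ↥(IndSub C 𝔽 W σ)), (x : S.GG → W) = stdFn C 𝔽 W σ 1 v →
    ∀ (U2 U1 : Finset S.GG),
      S.IsReps (S.Nk C.nK) (S.Nk (C.nK + 2)) U2 →
      S.IsReps (S.Nk (C.nK + 1)) (S.Nk (C.nK + 2)) U1 →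
      ((T x : S.GG → W)) =
        (∑ u ∈ U2, stdFn C 𝔽 W σ (u * S.alphaE⁻¹) (jσ (sigma' C 𝔽 W σ u⁻¹ v))) +
        ∑ u ∈ U1, stdFn C 𝔽 W σ (C.βK * u * S.alphaE⁻¹) (jσ (sigma' C 𝔽 W σ C.βK v)))

/-- The eigencharacter `χ_σ` of `H₀/H₁` afforded by the (one-dimensional) space
`σ^{I_{1,K}}` with chosen basis vector `v₀`. -/
def IsChi (v0 : W) (χ : S.GG → 𝔽) : Prop :=
  (∀ h ∈ C.H0, sigma' C 𝔽 W σ h v0 = χ h • v0)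

/-- Right translation on functions `K → 𝔽` (the action on a (finite) principal series). -/
def PSact (k : ↥C.K) (f : ↥C.K → 𝔽) : ↥C.K → 𝔽 := fun x => f (x * k)

/-- The (inflation to `K` of the) finite principal series `Ind_𝔹^{Γ_K} χ`:
functions on `K`, invariant under right translation by `K¹`, left `I_{1,K}`-invariant and
left `(H₀, χ)`-equivariant. -/
def PSchiSub (χ : S.GG → 𝔽) : Submodule 𝔽 (↥C.K → 𝔽) where
  carrier := {f | (∀ b : ↥C.K, (b : S.GG) ∈ C.I1 → ∀ x, f (b * x) = f x) ∧
                  (∀ h : ↥C.K, (h : S.GG) ∈ C.H0 → ∀ x, f (h * x) = χ (h : S.GG) * f x) ∧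
                  (∀ z : ↥C.K, (z : S.GG) ∈ C.KoneS → ∀ x, f (x * z) = f x)}
  add_mem' := by
    rintro f g ⟨hf1, hf2, hf3⟩ ⟨hg1, hg2, hg3⟩
    exact ⟨fun b hb x => by simp [hf1 b hb x, hg1 b hb x],
           fun h hh x => by simp [hf2 h hh x, hg2 h hh x, mul_add],
           fun z hz x => by simp [hf3 z hz x, hg3 z hz x]⟩
  zero_mem' := ⟨fun b hb x => rfl, fun h hh x => by simp, fun z hz x => rfl⟩
  smul_mem' := by
    rintro c f ⟨hf1, hf2, hf3⟩
    refine ⟨fun b hb x => by simp [hf1 b hb x], fun h hh x => ?_, fun z hz x => by simp [hf3 z hz x]⟩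
    simp only [Pi.smul_apply, hf2 h hh x, smul_eq_mul]
    ring

/-- The principal series `Ind_𝔹^{Γ_K} 1` for the trivial character. -/
def PS1sub : Submodule 𝔽 (↥C.K → 𝔽) := PSchiSub C 𝔽 (fun _ => 1)

/-- `σ_{st}` is the Steinberg weight `st = (Ind_𝔹^{Γ_K} 1)/1`: there is a surjective
`K`-equivariant linear map from `Ind_𝔹^{Γ_K} 1` to it whose kernel is exactly the
constant functions. -/
def IsSteinberg {Wst : Type} [AddCommGroup Wst] [Module 𝔽 Wst]
    (σst : Representation 𝔽 ↥C.K Wst) : Prop :=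
  ∃ φ : ↥(PS1sub C 𝔽) →ₗ[𝔽] Wst, Function.Surjective φ ∧
    (∀ f : ↥(PS1sub C 𝔽), φ f = 0 ↔ ∃ c : 𝔽, (f : ↥C.K → 𝔽) = fun _ => c) ∧
    (∀ (k : ↥C.K) (f f' : ↥(PS1sub C 𝔽)),
      (f' : ↥C.K → 𝔽) = PSact C 𝔽 k (f : ↥C.K → 𝔽) → φ f' = σst k (φ f))

/-- `σ` is isomorphic to a twist of the Steinberg weight by a character. -/
def IsTwistSteinberg : Prop :=
  ∃ (c : ↥C.K →* 𝔽ˣ) (φ : ↥(PS1sub C 𝔽) →ₗ[𝔽] W), Function.Surjective φ ∧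
    (∀ f : ↥(PS1sub C 𝔽), φ f = 0 ↔ ∃ cc : 𝔽, (f : ↥C.K → 𝔽) = fun _ => cc) ∧
    (∀ (k : ↥C.K) (f f' : ↥(PS1sub C 𝔽)),
      (f' : ↥C.K → 𝔽) = PSact C 𝔽 k (f : ↥C.K → 𝔽) →
        φ f' = (c k : 𝔽) • σ k (φ f))


/-- The `K`-subrepresentation of the quotient `(ind_K^G σ) / (range T)` generated by the
image of a vector `v`. -/
def genQuot (T : Module.End 𝔽 ↥(IndSub C 𝔽 W σ)) (v : ↥(IndSub C 𝔽 W σ)) :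
    Submodule 𝔽 (↥(IndSub C 𝔽 W σ) ⧸ LinearMap.range T) :=
  Submodule.span 𝔽 {w | ∃ k ∈ C.K, w = Submodule.Quotient.mk (indRep C 𝔽 W σ k v)}

end Weight

/-- Smoothness of a representation of `G`: every vector is fixed by some congruence
subgroup (equivalently, has open stabilizer). -/
def SmoothRep {V : Type} [AddCommGroup V] [Module 𝔽 V] (ρ : Representation 𝔽 S.GG V) : Prop :=
  ∀ v : V, ∃ n : ℕ, ∀ g ∈ S.cong n, ρ g v = v

end RepTheory

end U21

namespace U21

namespace Setting

variable {S : Setting}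

section FractionalIdeals

lemma mem_pE_iff {k : ℤ} {z : S.E} : z ∈ S.pE k ↔ S.ϖ ^ (-k) * z ∈ S.O := by
  have h := zpow_ne_zero k S.unif_ne
  constructor
  · rintro ⟨w, hw, rfl⟩
    rwa [zpow_neg, inv_mul_cancel_left₀ h]
  · intro hz
    exact ⟨_, hz, by rw [zpow_neg, mul_inv_cancel_left₀ h]⟩

lemma mem_pE_zero {z : S.E} : z ∈ S.pE 0 ↔ z ∈ S.O := by
  simp [mem_pE_iff]

lemma pE_mul {k l m : ℤ} {a b : S.E} (ha : a ∈ S.pE k) (hb : b ∈ S.pE l) (h : m ≤ k + l) :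
    a * b ∈ S.pE m := by
  obtain ⟨a, ha, rfl⟩ := ha
  obtain ⟨b, hb, rfl⟩ := hb
  obtain ⟨d, hd⟩ := Int.le.dest h
  refine ⟨S.ϖ ^ d * (a * b), S.O.mul_mem (S.O.pow_mem S.unif_mem _) (S.O.mul_mem ha hb), ?_⟩
  have : S.ϖ ^ k * S.ϖ ^ l = S.ϖ ^ m * S.ϖ ^ d := by
    rw [← zpow_natCast S.ϖ d, ← zpow_add₀ S.unif_ne, ← zpow_add₀ S.unif_ne, hd]
  linear_combination (a * b) * this

lemma one_mem_pE_zero : (1 : S.E) ∈ S.pE 0 := mem_pE_zero.2 S.O.one_mem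

lemma pE_mono {k l : ℤ} (h : l ≤ k) {a : S.E} (ha : a ∈ S.pE k) : a ∈ S.pE l := by
  simpa using pE_mul ha one_mem_pE_zero (by omega : l ≤ k + 0)

lemma zero_mem_pE (k : ℤ) : (0 : S.E) ∈ S.pE k := ⟨0, S.O.zero_mem, by simp⟩

lemma pE_add {k : ℤ} {a b : S.E} (ha : a ∈ S.pE k) (hb : b ∈ S.pE k) : a + b ∈ S.pE k := by
  rw [mem_pE_iff] at *
  rw [mul_add]
  exact S.O.add_mem ha hb

lemma pE_neg {k : ℤ} {a : S.E} (ha : a ∈ S.pE k) : -a ∈ S.pE k := by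
  rw [mem_pE_iff] at *
  rw [mul_neg]
  exact S.O.neg_mem ha

lemma pE_sub {k : ℤ} {a b : S.E} (ha : a ∈ S.pE k) (hb : b ∈ S.pE k) : a - b ∈ S.pE k := by
  rw [sub_eq_add_neg]
  exact pE_add ha (pE_neg hb)

lemma pE_conj {k : ℤ} {a : S.E} (ha : a ∈ S.pE k) : S.conj a ∈ S.pE k := by
  obtain ⟨w, hw, rfl⟩ := ha
  exact ⟨S.conj w, S.conj_O _ hw, by rw [map_mul, map_zpow₀, S.unif_conj]⟩

lemma zpow_mem_pE (k : ℤ) : S.ϖ ^ k ∈ S.pE k := ⟨1, S.O.one_mem, by simp⟩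

lemma one_notMem_pE_one : (1 : S.E) ∉ S.pE 1 := by
  rintro ⟨w, hw, h⟩
  refine S.unif_not_unit (IsUnit.of_mul_eq_one ⟨w, hw⟩ (Subtype.ext ?_))
  simpa using h.symm

lemma inv_mem_pE {k l : ℤ} {z : S.E} (hz : z ∉ S.pE k) (h : k + l ≤ 1) : z⁻¹ ∈ S.pE l := by
  by_cases h0 : z = 0
  · exact absurd (h0 ▸ zero_mem_pE k) hz
  obtain ⟨m, u, rfl⟩ := S.disc z h0
  have hu : ((u : S.O) : S.E) ∈ S.pE 0 := mem_pE_zero.2 u.1.2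
  have hu' : ((u⁻¹ : S.Oˣ) : S.O).1 ∈ S.pE 0 := mem_pE_zero.2 (u⁻¹).1.2
  have hm : m < k := by
    by_contra hm
    exact hz (pE_mul hu (zpow_mem_pE m) (by omega))
  have hinv : (((u : S.O) : S.E))⁻¹ = ((u⁻¹ : S.Oˣ) : S.O).1 := by
    refine inv_eq_of_mul_eq_one_right ?_
    exact congrArg Subtype.val (Units.mul_inv u)
  rw [mul_inv, hinv, ← zpow_neg]
  exact pE_mul hu' (zpow_mem_pE _) (by omega)

lemma mem_pE_of_norm {k l : ℤ} {w : S.E} (h : w * S.conj w ∈ S.pE l) (hkl : 2 * k ≤ l + 1) :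
    w ∈ S.pE k := by
  by_contra hw
  have h0 : w ≠ 0 := fun h0 => hw (h0 ▸ zero_mem_pE k)
  have h0' : S.conj w ≠ 0 := (map_ne_zero S.conj).2 h0
  have h1 : w⁻¹ ∈ S.pE (1 - k) := inv_mem_pE hw (by omega)
  have h2 := pE_mul h (pE_mul h1 (pE_conj h1) le_rfl)
    (by omega : 1 ≤ l + ((1 - k) + (1 - k)))
  rw [map_inv₀, mul_mul_mul_comm, mul_inv_cancel₀ h0, mul_inv_cancel₀ h0', mul_one] at h2
  exact one_notMem_pE_one h2

lemma mul_conj_mem_pE {k l m : ℤ} {x z : S.E} (hx : x * S.conj x ∈ S.pE k)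
    (hz : z * S.conj z ∈ S.pE l) (h : 2 * m ≤ k + l + 1) : x * S.conj z ∈ S.pE m := by
  refine mem_pE_of_norm (l := k + l) ?_ h
  rw [map_mul, S.conj_invol]
  have := pE_mul hx hz le_rfl
  convert this using 1
  ring

end FractionalIdeals

section Entries

lemma mat_mul (g h : S.GG) : S.mat (g * h) = S.mat g * S.mat h := rfl

lemma mat_mul_apply (g h : S.GG) (i j : Fin 3) :
    S.mat (g * h) i j =
      S.mat g i 0 * S.mat h 0 j + S.mat g i 1 * S.mat h 1 j + S.mat g i 2 * S.mat h 2 j := by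
  rw [mat_mul, Matrix.mul_apply, Fin.sum_univ_three]

lemma mat_one : S.mat (1 : S.GG) = 1 := rfl

lemma mat_injective {g h : S.GG} (H : S.mat g = S.mat h) : g = h :=
  Subtype.ext (Units.ext H)

lemma mat_form (g : S.GG) : (S.mat g).transpose * S.betaM * (S.mat g).map S.conj = S.betaM := g.2

lemma form_apply (M : S.M3) (i j : Fin 3) :
    (M.transpose * S.betaM * M.map S.conj) i j =
      M 2 i * S.conj (M 0 j) + M 1 i * S.conj (M 1 j) + M 0 i * S.conj (M 2 j) := by
  simp [Matrix.mul_apply, Fin.sum_univ_three, betaM]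

/-- The columns of an element of `G` satisfy the relations of the Hermitian form. -/
lemma column_relation (g : S.GG) (i j : Fin 3) :
    S.mat g 2 i * S.conj (S.mat g 0 j) + S.mat g 1 i * S.conj (S.mat g 1 j)
      + S.mat g 0 i * S.conj (S.mat g 2 j) = S.betaM i j := by
  rw [← form_apply, mat_form]

lemma adjoint_mul_of_form {M : S.M3}
    (h : M.transpose * S.betaM * M.map S.conj = S.betaM) :
    S.betaM * (M.map S.conj).transpose * S.betaM * M = 1 := by
  have hb : S.betaM.map S.conj = S.betaM := by
    ext i j; fin_cases i <;> fin_cases j <;> simp [betaM]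
  have hM : (M.map S.conj).map S.conj = M := by
    ext i j; simp [S.conj_invol]
  have h2 := congrArg (fun A : S.M3 => A.map S.conj) h
  simp only [Matrix.map_mul, hb, hM] at h2
  have h3 : (M.map S.conj).transpose * S.betaM * M = S.betaM := by
    rw [← Matrix.transpose_map] ; exact h2
  rw [mul_assoc, mul_assoc, ← mul_assoc (M.map S.conj).transpose, h3, S.beta_mul_beta]

lemma exists_mat_eq {M : S.M3} (h : ∀ i j, M 2 i * S.conj (M 0 j) + M 1 i * S.conj (M 1 j)
    + M 0 i * S.conj (M 2 j) = S.betaM i j) : ∃ g : S.GG, S.mat g = M := by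
  have h' : M.transpose * S.betaM * M.map S.conj = S.betaM := by
    ext i j; rw [form_apply, h]
  have h1 := adjoint_mul_of_form h'
  exact ⟨⟨⟨M, _, mul_eq_one_comm.1 h1, h1⟩, h'⟩, rfl⟩

lemma mat_inv (g : S.GG) :
    S.mat g⁻¹ = S.betaM * ((S.mat g).map S.conj).transpose * S.betaM := by
  have h1 := adjoint_mul_of_form (mat_form g)
  have h2 : S.mat g * S.mat g⁻¹ = 1 := by rw [← mat_mul, mul_inv_cancel, mat_one]
  calc S.mat g⁻¹ = (S.betaM * ((S.mat g).map S.conj).transpose * S.betaM * S.mat g) * S.mat g⁻¹ := by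
        rw [h1, one_mul]
    _ = _ := by rw [mul_assoc, h2, mul_one]

lemma mat_inv_apply (g : S.GG) (i j : Fin 3) :
    S.mat g⁻¹ i j = S.conj (S.mat g j.rev i.rev) := by
  rw [mat_inv]
  fin_cases i <;> fin_cases j <;>
    simp [Matrix.mul_apply, Fin.sum_univ_three, betaM, Fin.rev, Matrix.vecMul, dotProduct]

end Entries

section Unipotent

lemma mem_Nk_iff {k : ℤ} {g : S.GG} : g ∈ S.Nk k ↔
    S.mat g 0 0 = 1 ∧ S.mat g 1 1 = 1 ∧ S.mat g 2 2 = 1 ∧ S.mat g 1 0 = 0 ∧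
      S.mat g 2 0 = 0 ∧ S.mat g 2 1 = 0 ∧ S.mat g 0 2 ∈ S.pE k := by
  constructor
  · rintro ⟨x, y, -, hy, hg⟩
    simp [hg, nM, hy]
  · rintro ⟨h00, h11, h22, h10, h20, h21, h02⟩
    have h1 := column_relation g 1 2
    have h2 := column_relation g 2 2
    simp only [h11, h22, h21, betaM, map_one] at h1 h2
    simp at h1 h2
    have h12 : S.mat g 1 2 = - S.conj (S.mat g 0 1) := by
      have := congrArg S.conj h1
      rw [map_add, S.conj_invol, map_zero] at this
      linear_combination this
    refine ⟨S.mat g 0 1, S.mat g 0 2, ?_, h02, ?_⟩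
    · rw [h12, map_neg, S.conj_invol] at h2
      linear_combination h2
    · ext i j
      fin_cases i <;> fin_cases j <;> simp [nM, *]

lemma exists_mem_Nk {k : ℤ} {x y : S.E} (h : x * S.conj x + y + S.conj y = 0) (hy : y ∈ S.pE k) :
    ∃ g ∈ S.Nk k, S.mat g = S.nM x y := by
  obtain ⟨g, hg⟩ := exists_mat_eq (S := S) (M := S.nM x y) (by
    intro i j
    fin_cases i <;> fin_cases j <;> simp [nM, betaM, S.conj_invol]
    linear_combination h)
  exact ⟨g, ⟨x, y, h, hy, hg⟩, hg⟩

lemma norm_mem_of_trace {k : ℤ} {x y : S.E} (h : x * S.conj x + y + S.conj y = 0)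
    (hy : y ∈ S.pE k) : x * S.conj x ∈ S.pE k := by
  have : x * S.conj x = -(y + S.conj y) := by linear_combination h
  rw [this]
  exact pE_neg (pE_add hy (pE_conj hy))

/-- `N_k` as a subgroup of `G`. -/
def NkSub (S : Setting) (k : ℤ) : Subgroup S.GG where
  carrier := S.Nk k
  one_mem' := by
    rw [mem_Nk_iff]
    simp [mat_one, zero_mem_pE]
  mul_mem' := by
    rintro a b ⟨x, y, h, hy, ha⟩ ⟨x', y', h', hy', hb⟩
    rw [mem_Nk_iff]
    simp only [mat_mul_apply, ha, hb, nM]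
    simp
    refine pE_add (pE_add hy' (pE_neg ?_)) hy
    exact mul_conj_mem_pE (norm_mem_of_trace h hy) (norm_mem_of_trace h' hy') (by omega)
  inv_mem' := by
    rintro a ⟨x, y, h, hy, ha⟩
    rw [mem_Nk_iff]
    simp only [mat_inv_apply, ha, nM]
    simp [Fin.rev]
    exact pE_conj hy

lemma mem_NkSub {k : ℤ} {g : S.GG} : g ∈ S.NkSub k ↔ g ∈ S.Nk k := Iff.rfl

lemma Nk_anti {k l : ℤ} (h : l ≤ k) : S.NkSub k ≤ S.NkSub l := by
  intro g hg
  rw [mem_NkSub, mem_Nk_iff] at *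
  exact ⟨hg.1, hg.2.1, hg.2.2.1, hg.2.2.2.1, hg.2.2.2.2.1, hg.2.2.2.2.2.1,
    pE_mono h hg.2.2.2.2.2.2⟩

lemma inv_mul_mem_Nk {k : ℤ} (hk : -1 ≤ k) (hk1 : k ≤ 1) {a b : S.GG}
    (ha : a ∈ S.NkSub k) (hb : b ∈ S.NkSub k) (hx : S.mat b 0 1 - S.mat a 0 1 ∈ S.pE 1)
    (hd : S.mat b 0 2 - S.mat a 0 2 ∈ S.pE (k + 1)) : a⁻¹ * b ∈ S.NkSub (k + 1) := by
  obtain ⟨x, y, h, hy, ha⟩ := ha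
  obtain ⟨z, w, h', hw, hb⟩ := hb
  rw [mem_NkSub, mem_Nk_iff]
  simp only [mat_mul_apply, mat_inv_apply, ha, hb, nM] at *
  simp [Fin.rev] at *
  have hxk : x ∈ S.pE k := mem_pE_of_norm (l := k) (norm_mem_of_trace h hy) (by omega)
  have h1 := pE_mul hxk (pE_conj hx) (by omega : k + 1 ≤ _)
  have h2 := pE_add hd h1
  convert h2 using 1
  rw [map_sub, S.conj_invol]
  linear_combination h

/-- A subgroup `A` has a finite set of representatives modulo `B ≤ A` as soon as some map to a
finite type separates the cosets. -/
lemma _root_.Subgroup.exists_finset_reps {Γ Y : Type*} [Group Γ] [Finite Y] (A B : Subgroup Γ)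
    (hBA : B ≤ A) (f : Γ → Y) (hf : ∀ a ∈ A, ∀ b ∈ A, f a = f b → a⁻¹ * b ∈ B) :
    ∃ U : Finset Γ, (∀ u ∈ U, u ∈ A) ∧ ∀ a ∈ A, ∃! u, u ∈ U ∧ a⁻¹ * u ∈ B := by
  have hmem : ∀ q ∈ (QuotientGroup.mk '' (A : Set Γ) : Set (Γ ⧸ B)), q.out ∈ A := by
    rintro _ ⟨a, ha, rfl⟩
    obtain ⟨b, hb⟩ := QuotientGroup.mk_out_eq_mul B a
    rw [hb]
    exact A.mul_mem ha (hBA b.2)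
  have hfin : (QuotientGroup.mk '' (A : Set Γ) : Set (Γ ⧸ B)).Finite := by
    refine Set.Finite.of_injOn (f := fun q => f q.out) (t := Set.univ)
      (fun _ _ => Set.mem_univ _) ?_ Set.finite_univ
    intro q hq q' hq' h
    have := hf _ (hmem q hq) _ (hmem q' hq') h
    rwa [← QuotientGroup.eq, QuotientGroup.out_eq', QuotientGroup.out_eq'] at this
  refine ⟨hfin.toFinset.image Quotient.out, ?_, ?_⟩
  · intro u hu
    obtain ⟨q, hq, rfl⟩ := Finset.mem_image.1 hu
    exact hmem q (hfin.mem_toFinset.1 hq)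
  · intro a ha
    refine ⟨(QuotientGroup.mk a : Γ ⧸ B).out, ⟨Finset.mem_image_of_mem _
      (hfin.mem_toFinset.2 ⟨a, ha, rfl⟩), ?_⟩, ?_⟩
    · rw [← QuotientGroup.eq, QuotientGroup.out_eq']
    · rintro u ⟨hu, hau⟩
      obtain ⟨q, hq, rfl⟩ := Finset.mem_image.1 hu
      rw [← QuotientGroup.eq] at hau
      rw [hau]
      congr 1
      exact (QuotientGroup.out_eq' q).symm

/-- Reduction modulo `p_E` of an element of `o_E`, extended by zero to `E`. -/
def red (S : Setting) (z : S.E) : S.kE :=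
  if h : z ∈ S.O then S.resmap ⟨z, h⟩ else 0

lemma sub_mem_of_red_eq {z w : S.E} (hz : z ∈ S.pE 0) (hw : w ∈ S.pE 0)
    (h : S.red z = S.red w) : w - z ∈ S.pE 1 := by
  rw [mem_pE_zero] at hz hw
  simp only [red, hz, hw, dite_true, resmap] at h
  obtain ⟨y, hy, e⟩ := (S.hmI _).1 (Ideal.Quotient.eq.1 h.symm)
  exact ⟨y, hy, by simpa using e⟩

lemma exists_reps_Nk {k : ℤ} (hk : -1 ≤ k) (hk1 : k ≤ 1) :
    ∃ U : Finset S.GG, S.IsReps (S.Nk k) (S.Nk (k + 1)) U := by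
  refine Subgroup.exists_finset_reps (S.NkSub k) (S.NkSub (k + 1)) (Nk_anti (by omega))
    (fun g => (S.red (S.mat g 0 1), S.red (S.ϖ ^ (-k) * S.mat g 0 2))) ?_
  intro a ha b hb hab
  obtain ⟨h1, h2⟩ := Prod.mk.inj hab
  have hint : ∀ g ∈ S.NkSub k, S.mat g 0 1 ∈ S.pE 0 ∧ S.ϖ ^ (-k) * S.mat g 0 2 ∈ S.pE 0 := by
    rintro g ⟨x, y, h, hy, hg⟩
    simp only [hg, nM]
    simp only [Matrix.of_apply, Matrix.cons_val]
    exact ⟨mem_pE_of_norm (l := k) (norm_mem_of_trace h hy) (by omega),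
      pE_mul (zpow_mem_pE _) hy (by omega)⟩
  refine inv_mul_mem_Nk hk hk1 ha hb
    (sub_mem_of_red_eq (hint a ha).1 (hint b hb).1 h1) ?_
  have h3 := sub_mem_of_red_eq (hint a ha).2 (hint b hb).2 h2
  have h4 := pE_mul (zpow_mem_pE k) h3 le_rfl
  rwa [← mul_sub, ← mul_assoc, ← zpow_add₀ S.unif_ne, add_neg_cancel, zpow_zero, one_mul] at h4

end Unipotent

end Setting

end U21

namespace U21

namespace Setting

variable {S : Setting}

lemma mat_alphaE : S.mat S.alphaE = S.alphaM := rfl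

lemma mat_alphaE_inv : S.mat S.alphaE⁻¹ = S.alphaMinv := rfl

lemma conj_alphaE_mem_Nk {k : ℤ} {u : S.GG} (hu : u ∈ S.NkSub (k + 2)) :
    S.alphaE * u * S.alphaE⁻¹ ∈ S.NkSub k := by
  obtain ⟨x, y, -, hy, hu⟩ := hu
  rw [mem_NkSub, mem_Nk_iff]
  simp only [mat_mul_apply, mat_alphaE, mat_alphaE_inv, hu, nM, alphaM, alphaMinv]
  simp [S.unif_ne]
  have := pE_mul (zpow_mem_pE (-2)) hy (by omega : k ≤ _)
  convert this using 1
  rw [zpow_neg]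
  field_simp [S.unif_ne]

lemma conj_alphaE_inv_mem_Nk {k : ℤ} {u : S.GG} (hu : u ∈ S.NkSub k) :
    S.alphaE⁻¹ * u * S.alphaE ∈ S.NkSub (k + 2) := by
  obtain ⟨x, y, -, hy, hu⟩ := hu
  rw [mem_NkSub, mem_Nk_iff]
  simp only [mat_mul_apply, mat_alphaE, mat_alphaE_inv, hu, nM, alphaM, alphaMinv]
  simp [S.unif_ne]
  have := pE_mul (zpow_mem_pE 2) hy (by omega : k + 2 ≤ _)
  convert this using 1
  norm_cast
  ring

end Setting

namespace Chamber

open Setting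

variable {S : Setting} (C : Chamber S)

lemma nK_cases : C.nK = 0 ∨ C.nK = -1 := by
  rcases C.cases with h | h
  · exact Or.inl h.2.2.2.2.2.2.1
  · exact Or.inr h.2.2.2.2.2.2.1

lemma mem_K_iff {g : S.GG} : g ∈ C.K ↔
    (S.mat g 0 0 ∈ S.pE 0 ∧ S.mat g 0 1 ∈ S.pE 0 ∧ S.mat g 0 2 ∈ S.pE C.nK) ∧
    (S.mat g 1 0 ∈ S.pE (-C.nK) ∧ S.mat g 1 1 ∈ S.pE 0 ∧ S.mat g 1 2 ∈ S.pE 0) ∧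
    (S.mat g 2 0 ∈ S.pE (-C.nK) ∧ S.mat g 2 1 ∈ S.pE (-C.nK) ∧ S.mat g 2 2 ∈ S.pE 0) := by
  rw [← SetLike.mem_coe]
  rcases C.cases with ⟨h, -, -, -, -, -, hn, -⟩ | ⟨h, -, -, -, -, -, hn, -⟩
  · rw [h, hn]
    simp only [K0set, Set.mem_ofPred_eq, Fin.forall_fin_succ, neg_zero, mem_pE_zero]
    simp
  · rw [h, hn]
    simp only [K1set, Set.mem_ofPred_eq, mem_pE_zero, neg_neg]
    tauto

lemma mem_I1_iff {g : S.GG} : g ∈ C.I1 ↔ g ∈ C.IK ∧ S.mat g 0 0 - 1 ∈ S.pE 1 ∧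
    S.mat g 1 1 - 1 ∈ S.pE 1 ∧ S.mat g 2 2 - 1 ∈ S.pE 1 := by
  rcases C.cases with ⟨-, -, h, h', -⟩ | ⟨-, -, h, h', -⟩ <;> rw [h, h'] <;> rfl

lemma mem_IK_of {g : S.GG} (hg : g ∈ C.K) (h10 : S.mat g 1 0 ∈ S.pE 1)
    (h20 : S.mat g 2 0 ∈ S.pE (1 - C.nK)) (h21 : S.mat g 2 1 ∈ S.pE 1) : g ∈ C.IK := by
  rw [← SetLike.mem_coe] at hg
  rcases C.cases with ⟨h, -, h', -, -, -, hn, -⟩ | ⟨h, -, h', -, -, -, hn, -⟩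
  · rw [h] at hg
    rw [h']
    rw [hn] at h20
    exact ⟨hg, h10, by simpa using h20, h21⟩
  · rw [h] at hg
    rw [h']
    rw [hn] at h20
    exact ⟨hg, by simpa using h20⟩

lemma IK_entries {g : S.GG} (hg : g ∈ C.IK) : g ∈ C.K ∧ S.mat g 1 0 ∈ S.pE 1 ∧
    S.mat g 2 0 ∈ S.pE (1 - C.nK) ∧ S.mat g 2 1 ∈ S.pE 1 := by
  rw [← SetLike.mem_coe]
  rcases C.cases with ⟨h, -, h', -, -, -, hn, -⟩ | ⟨h, -, h', -, -, -, hn, -⟩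
  · rw [h'] at hg
    rw [h, hn]
    exact ⟨hg.1, hg.2.1, by simpa using hg.2.2.1, hg.2.2.2⟩
  · rw [h'] at hg
    rw [h, hn]
    exact ⟨hg.1, hg.1.2.2.2.1, by simpa using hg.2, hg.1.2.2.2.2.2.2.2.1⟩

lemma mem_I1'_of {g : S.GG} (hg : g ∈ C.K) (h01 : S.mat g 0 1 ∈ S.pE (C.nK + 1))
    (h02 : S.mat g 0 2 ∈ S.pE (C.nK + 1)) (h12 : S.mat g 1 2 ∈ S.pE (C.nK + 1))
    (h00 : S.mat g 0 0 - 1 ∈ S.pE 1) (h11 : S.mat g 1 1 - 1 ∈ S.pE 1)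
    (h22 : S.mat g 2 2 - 1 ∈ S.pE 1) : g ∈ C.I1' := by
  rw [← SetLike.mem_coe] at hg
  rcases C.cases with ⟨h, -, -, -, h', -, hn, -⟩ | ⟨h, -, -, -, h', -, hn, -⟩
  · rw [h] at hg
    rw [h']
    rw [hn] at h01 h02 h12
    exact ⟨hg, by simpa using h01, by simpa using h02, by simpa using h12, h00, h11, h22⟩
  · rw [h] at hg
    rw [h']
    rw [hn] at h02
    exact ⟨hg, mem_pE_zero.1 (by simpa using h02), h00, h11, h22⟩

lemma mem_Kone_of {g : S.GG} (hg : g ∈ C.IK) (h01 : S.mat g 0 1 ∈ S.pE (C.nK + 1))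
    (h02 : S.mat g 0 2 ∈ S.pE (C.nK + 1)) (h12 : S.mat g 1 2 ∈ S.pE (C.nK + 1))
    (h00 : S.mat g 0 0 - 1 ∈ S.pE 1) (h11 : S.mat g 1 1 - 1 ∈ S.pE 1)
    (h22 : S.mat g 2 2 - 1 ∈ S.pE 1) : g ∈ C.KoneS := by
  obtain ⟨hK, h10, h20, h21⟩ := C.IK_entries hg
  rw [← SetLike.mem_coe] at hK
  rcases C.cases with ⟨-, h, -, -, -, -, hn, -⟩ | ⟨h', h, -, -, -, -, hn, -⟩
  · rw [h]
    rw [hn] at h01 h02 h12 h20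
    rw [zero_add] at h01 h02 h12
    rw [sub_zero] at h20
    intro i j
    fin_cases i <;> fin_cases j <;> simpa
  · rw [h]
    rw [h'] at hK
    rw [hn] at h02 h20
    exact ⟨hK, mem_pE_zero.1 (by simpa using h02), by simpa using h20, h00, h11, h22⟩

lemma mat_βK : S.mat C.βK = !![0, 0, S.ϖ ^ C.nK; 0, 1, 0; S.ϖ ^ (-C.nK), 0, 0] := by
  rcases C.cases with ⟨-, -, -, -, -, h, hn, -⟩ | ⟨-, -, -, -, -, h, hn, -⟩
  · rw [h, hn]
    simp only [neg_zero, zpow_zero]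
    rfl
  · rw [h, hn]
    ext i j
    rw [betaPr, mat_mul_apply, mat_alphaE_inv, show S.mat S.betaE = S.betaM from rfl]
    fin_cases i <;> fin_cases j <;> simp [betaM, alphaMinv]

lemma βK_mem : C.βK ∈ C.K := by
  rw [mem_K_iff]
  simp [C.mat_βK, zero_mem_pE, zpow_mem_pE, one_mem_pE_zero]
  simpa using zpow_mem_pE (S := S) (-C.nK)

lemma βK_mul_self : C.βK * C.βK = 1 := by
  apply mat_injective
  ext i j
  rw [mat_mul_apply, C.mat_βK, mat_one]
  have := zpow_ne_zero C.nK S.unif_ne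
  fin_cases i <;> fin_cases j <;> simp [this]

lemma βK_mul_cancel_left (g : S.GG) : C.βK * (C.βK * g) = g := by
  rw [← mul_assoc, C.βK_mul_self, one_mul]

lemma βK_inv : C.βK⁻¹ = C.βK := inv_eq_of_mul_eq_one_left C.βK_mul_self

lemma βK_alphaE : C.βK * S.alphaE * C.βK = S.alphaE⁻¹ := by
  apply mat_injective
  ext i j
  have := zpow_ne_zero C.nK S.unif_ne
  rw [mat_mul_apply, mat_mul_apply, mat_mul_apply, mat_mul_apply, C.mat_βK, mat_alphaE,
    mat_alphaE_inv]
  fin_cases i <;> fin_cases j <;> simp [alphaM, alphaMinv] <;> field_simp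

lemma mat_βK_conj {u : S.GG} {x y : S.E} (hu : S.mat u = S.nM x y) :
    S.mat (C.βK * u * C.βK) =
      !![1, 0, 0; -S.conj x * S.ϖ ^ (-C.nK), 1, 0;
        S.ϖ ^ (-C.nK) * y * S.ϖ ^ (-C.nK), S.ϖ ^ (-C.nK) * x, 1] := by
  ext i j
  have := zpow_ne_zero C.nK S.unif_ne
  rw [mat_mul_apply, mat_mul_apply, mat_mul_apply, mat_mul_apply, C.mat_βK, hu]
  fin_cases i <;> fin_cases j <;> simp [nM, this]

lemma Nk_le_K {u : S.GG} (hu : u ∈ S.NkSub C.nK) : u ∈ C.K := by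
  obtain ⟨x, y, h, hy, hu⟩ := hu
  have hx : x ∈ S.pE 0 := mem_pE_of_norm (norm_mem_of_trace h hy)
    (by rcases C.nK_cases with h | h <;> omega)
  rw [mem_K_iff]
  simp [hu, nM, zero_mem_pE, one_mem_pE_zero, hx, hy, pE_neg (pE_conj hx)]

lemma Nk_le_I1 {u : S.GG} (hu : u ∈ S.NkSub C.nK) : u ∈ C.I1 := by
  have hK := C.Nk_le_K hu
  rw [mem_NkSub, mem_Nk_iff] at hu
  obtain ⟨h00, h11, h22, h10, h20, h21, -⟩ := hu
  rw [mem_I1_iff]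
  refine ⟨C.mem_IK_of hK ?_ ?_ ?_, ?_, ?_, ?_⟩ <;> simp [*, zero_mem_pE]

lemma Nk_le_Kone {u : S.GG} (hu : u ∈ S.NkSub (C.nK + 1)) : u ∈ C.KoneS := by
  have hI := ((C.mem_I1_iff).1 (C.Nk_le_I1 (Nk_anti (by omega) hu))).1
  obtain ⟨x, y, h, hy, hu⟩ := hu
  have hx : x ∈ S.pE (C.nK + 1) := mem_pE_of_norm (norm_mem_of_trace h hy)
    (by rcases C.nK_cases with h | h <;> omega)
  refine C.mem_Kone_of hI ?_ ?_ ?_ ?_ ?_ ?_ <;>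
    simp [hu, nM, zero_mem_pE, hx, hy, pE_neg (pE_conj hx)]

lemma βK_conj_mem_I1' {u : S.GG} (hu : u ∈ S.NkSub C.nK) : C.βK * u * C.βK ∈ C.I1' := by
  have hK := C.K.mul_mem (C.K.mul_mem C.βK_mem (C.Nk_le_K hu)) C.βK_mem
  obtain ⟨x, y, h, hy, hu⟩ := hu
  refine C.mem_I1'_of hK ?_ ?_ ?_ ?_ ?_ ?_ <;> simp [C.mat_βK_conj hu, zero_mem_pE]

lemma βK_conj_mem_I1 {u : S.GG} (hu : u ∈ S.NkSub (C.nK + 1)) : C.βK * u * C.βK ∈ C.I1 := by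
  have hK := C.K.mul_mem (C.K.mul_mem C.βK_mem (C.Nk_le_K (Nk_anti (by omega) hu))) C.βK_mem
  obtain ⟨x, y, h, hy, hu⟩ := hu
  have hx : x ∈ S.pE (C.nK + 1) := mem_pE_of_norm (norm_mem_of_trace h hy)
    (by rcases C.nK_cases with h | h <;> omega)
  rw [mem_I1_iff]
  refine ⟨C.mem_IK_of hK ?_ ?_ ?_, ?_, ?_, ?_⟩ <;> rw [C.mat_βK_conj hu]
  · exact pE_mul (pE_neg (pE_conj hx)) (zpow_mem_pE _) (by omega)
  · exact pE_mul (pE_mul (zpow_mem_pE _) hy le_rfl) (zpow_mem_pE _) (by omega)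
  · exact pE_mul (zpow_mem_pE _) hx (by omega)
  all_goals simp [zero_mem_pE]

lemma inv_mem_I1 {g : S.GG} (hg : g ∈ C.I1) : g⁻¹ ∈ C.I1 := by
  rw [mem_I1_iff] at *
  obtain ⟨hI, h00, h11, h22⟩ := hg
  obtain ⟨hK, h10, h20, h21⟩ := C.IK_entries hI
  refine ⟨C.mem_IK_of (C.K.inv_mem hK) ?_ ?_ ?_, ?_, ?_, ?_⟩ <;> rw [mat_inv_apply]
  · exact pE_conj h21
  · exact pE_conj h20
  · exact pE_conj h10
  · simpa using pE_conj h22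
  · simpa using pE_conj h11
  · simpa using pE_conj h00

lemma mem_Hset_iff {h : S.GG} : h ∈ S.Hset ↔ S.mat h 0 1 = 0 ∧ S.mat h 0 2 = 0 ∧
    S.mat h 1 0 = 0 ∧ S.mat h 1 2 = 0 ∧ S.mat h 2 0 = 0 ∧ S.mat h 2 1 = 0 := by
  constructor
  · rintro ⟨a, b, c, hh⟩
    simp [hh]
  · rintro ⟨h01, h02, h10, h12, h20, h21⟩
    refine ⟨S.mat h 0 0, S.mat h 1 1, S.mat h 2 2, ?_⟩
    ext i j
    fin_cases i <;> fin_cases j <;> simp [*]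

lemma Hset_comm {h h' : S.GG} (H : h ∈ S.Hset) (H' : h' ∈ S.Hset) : h * h' = h' * h := by
  obtain ⟨a, b, c, hh⟩ := H
  obtain ⟨a', b', c', hh'⟩ := H'
  apply mat_injective
  ext i j
  rw [mat_mul_apply, mat_mul_apply, hh, hh']
  fin_cases i <;> fin_cases j <;> simp [mul_comm]

lemma alphaE_mem_Hset : S.alphaE ∈ S.Hset := ⟨_, _, _, rfl⟩

/-- `H₀` as a subgroup of `G`. -/
def H0Sub : Subgroup S.GG where
  carrier := {h | h ∈ S.Hset ∧ h ∈ C.K}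
  one_mem' := ⟨by simp [mem_Hset_iff, mat_one], C.K.one_mem⟩
  mul_mem' := by
    rintro a b ⟨ha, ha'⟩ ⟨hb, hb'⟩
    refine ⟨?_, C.K.mul_mem ha' hb'⟩
    rw [mem_Hset_iff] at *
    simp [mat_mul_apply, *]
  inv_mem' := by
    rintro a ⟨ha, ha'⟩
    refine ⟨?_, C.K.inv_mem ha'⟩
    rw [mem_Hset_iff] at *
    simp [mat_inv_apply, Fin.rev, *]

lemma βK_conj_mem_H0 {h : S.GG} (hh : h ∈ C.H0Sub) : C.βK * h * C.βK ∈ C.H0Sub := by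
  refine ⟨?_, C.K.mul_mem (C.K.mul_mem C.βK_mem hh.2) C.βK_mem⟩
  have := mem_Hset_iff.1 hh.1
  rw [mem_Hset_iff]
  simp [mat_mul_apply, C.mat_βK, this]

lemma H0_conj_mem_Nk {h u : S.GG} {k : ℤ} (hh : h ∈ C.H0Sub) (hu : u ∈ S.NkSub k) :
    h * u * h⁻¹ ∈ S.NkSub k := by
  obtain ⟨H, hK⟩ := hh
  have hKi := C.K.inv_mem hK
  rw [mem_K_iff] at hK hKi
  obtain ⟨a, b, c, hm⟩ := H
  obtain ⟨x, y, -, hy, hu⟩ := hu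
  have r1 := column_relation h 0 2
  have r2 := column_relation h 1 1
  have r3 := column_relation h 2 0
  rw [mem_NkSub, mem_Nk_iff]
  simp only [mat_mul_apply, mat_inv_apply, hm, hu, nM, betaM] at *
  simp [Fin.rev] at *
  refine ⟨r1, r2, r3, ?_⟩
  exact pE_mul (pE_mul hK.1.1 hy le_rfl) hKi.2.2.2 (by omega : k ≤ 0 + k + 0)

lemma upper_decomp {g : S.GG} (hg : g ∈ C.K) (h10 : S.mat g 1 0 = 0) (h20 : S.mat g 2 0 = 0) :
    ∃ h ∈ C.H0Sub, ∃ u ∈ S.NkSub C.nK, g = h * u ∧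
      ∀ i, S.mat h i i = S.mat g i i := by
  have r00 := column_relation g 0 0
  have r01 := column_relation g 0 1
  have r02 := column_relation g 0 2
  have r11 := column_relation g 1 1
  have r20 := column_relation g 2 0
  simp only [h10, h20, betaM] at r00 r01 r02 r11 r20
  simp at r00 r01 r02 r11 r20
  have h00 : S.mat g 0 0 ≠ 0 := by
    intro h
    simp [h] at r02
  have h21 : S.mat g 2 1 = 0 := r01.resolve_left h00
  simp only [h21, map_zero, mul_zero, zero_mul, add_zero, zero_add] at r11
  obtain ⟨h, hh⟩ := exists_mat_eq (S := S)
    (M := !![S.mat g 0 0, 0, 0; 0, S.mat g 1 1, 0; 0, 0, S.mat g 2 2]) (by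
      intro i j
      fin_cases i <;> fin_cases j <;> simp [betaM, r11, r02, r20])
  have hK : h ∈ C.K := by
    rw [mem_K_iff] at hg ⊢
    simp [hh, zero_mem_pE, hg]
  have hH : h ∈ C.H0Sub := ⟨⟨_, _, _, hh⟩, hK⟩
  refine ⟨h, hH, h⁻¹ * g, ?_, by rw [mul_inv_cancel_left], ?_⟩
  · have hK' := (C.mem_K_iff).1 (C.K.mul_mem (C.K.inv_mem hK) hg)
    rw [mem_NkSub, mem_Nk_iff]
    refine ⟨?_, ?_, ?_, ?_, ?_, ?_, hK'.1.2.2⟩ <;> rw [mat_mul_apply] <;>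
      simp only [mat_inv_apply, hh] <;> simp [Fin.rev, h10, h20, h21]
    · rw [mul_comm, r02]
    · rw [mul_comm, r11]
    · rw [mul_comm, r20]
  · intro i
    rw [hh]
    fin_cases i <;> simp

lemma bigcell_decomp {g : S.GG} (hg : g ∈ C.K) (h20 : S.mat g 2 0 ∉ S.pE (1 - C.nK)) :
    ∃ u₁ ∈ S.NkSub C.nK, ∃ h ∈ C.H0Sub, ∃ u₂ ∈ S.NkSub C.nK, g = u₁ * C.βK * h * u₂ := by
  have hK := (C.mem_K_iff).1 hg
  have hc : S.mat g 2 0 ≠ 0 := fun h => h20 (h ▸ zero_mem_pE _)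
  have hc' := (map_ne_zero S.conj).2 hc
  have r := column_relation g 0 0
  simp only [betaM] at r
  simp at r
  obtain ⟨u, hu, hm⟩ := exists_mem_Nk (S := S) (k := C.nK)
    (x := -S.conj (S.mat g 1 0 * (S.mat g 2 0)⁻¹)) (y := S.mat g 0 0 * (S.mat g 2 0)⁻¹) (by
      simp only [map_mul, map_neg, map_inv₀, S.conj_invol]
      field_simp
      linear_combination r)
    (pE_mul hK.1.1 (inv_mem_pE h20 (by omega : _ + C.nK ≤ 1)) (by omega))
  have hK' := C.K.mul_mem (C.K.mul_mem C.βK_mem (C.K.inv_mem (C.Nk_le_K hu))) hg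
  obtain ⟨h, hh, u₂, hu₂, e, -⟩ := C.upper_decomp hK' (by
      rw [mat_mul_apply, mat_mul_apply, mat_mul_apply, mat_mul_apply, C.mat_βK]
      simp only [mat_inv_apply, hm, nM]
      simp [Fin.rev, S.conj_invol, hc]) (by
      rw [mat_mul_apply, mat_mul_apply, mat_mul_apply, mat_mul_apply, C.mat_βK]
      simp only [mat_inv_apply, hm, nM]
      simp [Fin.rev, S.conj_invol]
      field_simp
      have : S.ϖ ^ (-C.nK) ≠ 0 := zpow_ne_zero _ S.unif_ne
      linear_combination (S.ϖ ^ C.nK)⁻¹ * r)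
  refine ⟨u, hu, h, hh, u₂, hu₂, ?_⟩
  rw [mul_assoc _ h, ← e]
  simp only [mul_assoc, βK_mul_cancel_left, mul_inv_cancel_left]

lemma mem_IK_of_corner {g : S.GG} (hg : g ∈ C.K) (h20 : S.mat g 2 0 ∈ S.pE (1 - C.nK)) :
    g ∈ C.IK := by
  have key : ∀ g ∈ C.K, S.mat g 2 0 ∈ S.pE (1 - C.nK) → S.mat g 1 0 ∈ S.pE 1 := by
    intro g hg h20
    have hK := (C.mem_K_iff).1 hg
    rcases C.nK_cases with hn | hn
    · have r := column_relation g 0 0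
      simp only [betaM] at r
      simp at r
      have h1 := pE_mul h20 (pE_conj hK.1.1) (by omega : 1 ≤ 1 - C.nK + 0)
      have h2 := pE_conj h1
      rw [map_mul, S.conj_invol] at h2
      refine mem_pE_of_norm (l := 1) ?_ (by omega)
      convert pE_neg (pE_add h1 h2) using 1
      linear_combination r
    · exact pE_mono (by omega) hK.2.1.1
  refine C.mem_IK_of hg (key g hg h20) h20 ?_
  have := key g⁻¹ (C.K.inv_mem hg) (by rw [mat_inv_apply]; exact pE_conj h20)
  rw [mat_inv_apply] at this
  simpa [S.conj_invol] using pE_conj this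

lemma iwahori_decomp {g : S.GG} (hg : g ∈ C.IK) :
    ∃ m ∈ S.NkSub (C.nK + 1), ∃ h ∈ C.H0Sub, ∃ u ∈ S.NkSub C.nK,
      g = C.βK * m * C.βK * h * u ∧ (g ∈ C.I1 → h ∈ C.KoneS) := by
  obtain ⟨hgK, h10, h20, h21⟩ := C.IK_entries hg
  have hK := (C.mem_K_iff).1 hgK
  have r := column_relation g 0 0
  have r02 := column_relation g 0 2
  simp only [betaM] at r r02
  simp at r r02
  have ha : S.mat g 0 0 ∉ S.pE 1 := by
    intro ha
    refine one_notMem_pE_one (S := S) ?_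
    rw [← r02]
    refine pE_add (pE_add ?_ ?_) ?_
    · exact pE_mul h20 (pE_conj hK.1.2.2) (by omega)
    · exact pE_mul h10 (pE_conj hK.2.1.2.2) (by omega)
    · exact pE_mul ha (pE_conj hK.2.2.2.2) (by omega)
  have ha0 : S.mat g 0 0 ≠ 0 := fun h => ha (h ▸ zero_mem_pE _)
  have ha0' := (map_ne_zero S.conj).2 ha0
  have hw : S.ϖ ^ C.nK ≠ 0 := zpow_ne_zero _ S.unif_ne
  have hai : (S.mat g 0 0)⁻¹ ∈ S.pE 0 := inv_mem_pE ha (by omega)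
  obtain ⟨m, hm, hmm⟩ := exists_mem_Nk (S := S) (k := C.nK + 1)
    (x := -S.conj (S.ϖ ^ C.nK * (S.mat g 1 0 * (S.mat g 0 0)⁻¹)))
    (y := S.ϖ ^ C.nK * (S.ϖ ^ C.nK * (S.mat g 2 0 * (S.mat g 0 0)⁻¹))) (by
      simp only [map_mul, map_neg, map_inv₀, S.conj_invol, map_zpow₀, S.unif_conj]
      field_simp
      linear_combination (S.ϖ ^ C.nK) ^ 2 * r)
    (pE_mul (zpow_mem_pE _) (pE_mul (zpow_mem_pE _) (pE_mul h20 hai le_rfl) le_rfl) (by omega))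
  have hn := C.mat_βK_conj hmm
  simp only [map_neg, S.conj_invol, zpow_neg] at hn
  have hbK : C.βK * m * C.βK ∈ C.K :=
    C.K.mul_mem (C.K.mul_mem C.βK_mem (C.Nk_le_K (Nk_anti (by omega) hm))) C.βK_mem
  have hK' := C.K.mul_mem (C.K.inv_mem hbK) hgK
  set g' := (C.βK * m * C.βK)⁻¹ * g with hg'
  have hgg : g = C.βK * m * C.βK * g' := by rw [hg', mul_inv_cancel_left]
  have e0 : S.mat g 0 0 = S.mat g' 0 0 := by
    conv_lhs => rw [hgg]
    rw [mat_mul_apply, hn]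
    simp
  have e1 : S.mat g' 1 0 = 0 := by
    have : S.mat g 1 0 = S.mat (C.βK * m * C.βK * g') 1 0 := congrArg (S.mat · 1 0) hgg
    rw [mat_mul_apply, hn] at this
    simp at this
    field_simp at this
    rw [← e0] at this
    refine (mul_eq_zero.1 ?_).resolve_left ha0
    linear_combination -this
  have e2 : S.mat g' 2 0 = 0 := by
    have : S.mat g 2 0 = S.mat (C.βK * m * C.βK * g') 2 0 := congrArg (S.mat · 2 0) hgg
    rw [mat_mul_apply, hn] at this
    simp [e1] at this
    field_simp at this
    rw [← e0] at this
    refine (mul_eq_zero.1 ?_).resolve_left ha0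
    linear_combination -this
  obtain ⟨h, hh, u, hu, e, hd⟩ := C.upper_decomp hK' e1 e2
  refine ⟨m, hm, h, hh, u, hu, by rw [mul_assoc _ h, ← e, ← hgg], ?_⟩
  intro hI
  obtain ⟨-, d0, d1, d2⟩ := (C.mem_I1_iff).1 hI
  obtain ⟨z01, z02, z10, z12, z20, z21⟩ := mem_Hset_iff.1 hh.1
  have q := column_relation g' 0 2
  simp only [betaM] at q
  simp only [e1, e2] at q
  simp at q
  refine C.mem_Kone_of (C.mem_IK_of hh.2 ?_ ?_ ?_) ?_ ?_ ?_ ?_ ?_ ?_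
  any_goals simp only [z01, z02, z10, z12, z20, z21, hd, zero_mem_pE]
  · rwa [← e0]
  · have : S.mat g 1 1 = S.mat (C.βK * m * C.βK * g') 1 1 := congrArg (S.mat · 1 1) hgg
    rw [mat_mul_apply, hn] at this
    simp at this
    have hK'' := (C.mem_K_iff).1 hK'
    have h3 := pE_mul (pE_mul h10 hai le_rfl) hK''.1.2.1 (by omega : (1 : ℤ) ≤ 1 + 0 + 0)
    have h4 := pE_sub d1 h3
    convert h4 using 1
    rw [this]
    field_simp
    ring
  · have h5 := pE_conj (pE_mul (pE_neg d0) (pE_conj ((C.mem_K_iff).1 hK').2.2.2.2)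
      (by omega : 1 ≤ (1 : ℤ) + 0))
    rw [map_mul, S.conj_invol] at h5
    convert h5 using 1
    have q' := congrArg S.conj q
    simp [S.conj_invol, e0] at q' ⊢
    linear_combination q'

end Chamber

end U21

namespace U21

section Abstract

variable {k Γ W : Type} [Field k] [Group Γ] [AddCommGroup W] [Module k W]
  (ρ : Representation k Γ W)

/-- A commutative group acting on a finite dimensional space over an algebraically closed field
has a common eigenvector. -/
lemma exists_common_eigenvector [IsAlgClosed k] [FiniteDimensional k W] {H : Subgroup Γ}
    (hH : ∀ h ∈ H, ∀ h' ∈ H, h * h' = h' * h) (L : Submodule k W) (hL : L ≠ ⊥)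
    (hst : ∀ h ∈ H, ∀ v ∈ L, ρ h v ∈ L) :
    ∃ v ∈ L, v ≠ 0 ∧ ∀ h ∈ H, ∃ c : k, ρ h v = c • v := by
  induction hd : Module.finrank k L using Nat.strong_induction_on generalizing L with
  | _ d ih =>
  by_cases hs : ∀ h ∈ H, ∃ c : k, ∀ v ∈ L, ρ h v = c • v
  · obtain ⟨v, hv, hv0⟩ := L.exists_mem_ne_zero_of_ne_bot hL
    exact ⟨v, hv, hv0, fun h hh => (hs h hh).imp fun c hc => hc v hv⟩
  · push Not at hs
    obtain ⟨h, hh, hs⟩ := hs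
    have : Nontrivial L := Submodule.nontrivial_iff_ne_bot.2 hL
    obtain ⟨c, hc⟩ := Module.End.exists_eigenvalue ((ρ h).restrict (hst h hh))
    obtain ⟨w, hw⟩ := hc.exists_hasEigenvector
    have hw1 : ρ h w = c • (w : W) := congrArg Subtype.val hw.apply_eq_smul
    let L' : Submodule k W := L ⊓ LinearMap.ker (ρ h - c • LinearMap.id)
    have hmem : ∀ v, v ∈ L' ↔ v ∈ L ∧ ρ h v = c • v := fun v => by
      simp [L', sub_eq_zero]
    have hL' : L' ≠ ⊥ := by
      refine Submodule.ne_bot_iff _ |>.2 ⟨w, (hmem _).2 ⟨w.2, hw1⟩, ?_⟩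
      simpa using hw.2
    have hlt : L' < L := by
      refine lt_of_le_of_ne inf_le_left fun he => ?_
      obtain ⟨v, hv, hv'⟩ := hs c
      exact hv' ((hmem v).1 (he ▸ hv)).2
    obtain ⟨v, hv, hv'⟩ := ih _ (hd ▸ Submodule.finrank_lt_finrank_of_lt hlt) L' hL' (by
      intro h' hh' v hv
      rw [hmem] at hv ⊢
      refine ⟨hst h' hh' v hv.1, ?_⟩
      rw [← Module.End.mul_apply, ← map_mul, hH h hh h' hh', map_mul, Module.End.mul_apply, hv.2,
        map_smul]) rfl
    exact ⟨v, hlt.le hv, hv'⟩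

/-- In a representation of a group with a Bruhat-type relation between a finite subgroup `N`,
a commutative subgroup `H` and an involution `b`, some `N`-invariant `H`-eigenvector `v`
has `N b v` contained in the span of the orbit of `v` under `b N b`. -/
lemma exists_eigenvector_mem_span_opposite [IsAlgClosed k] [FiniteDimensional k W]
    {N H : Subgroup Γ} [Finite N] {b z : Γ} (hb : b * b = 1)
    (hH : ∀ h ∈ H, ∀ h' ∈ H, h * h' = h' * h)
    (hHN : ∀ h ∈ H, ∀ n ∈ N, h * n * h⁻¹ ∈ N)
    (hbH : ∀ h ∈ H, b * h * b ∈ H)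
    (hBr : ∀ u ∈ N, u ≠ 1 → ∃ u₁ ∈ N, ∃ h ∈ H, ∃ u₂ ∈ N, b * u * b = u₁ * b * h * u₂)
    (hz : z ≠ 1 → (Nat.card N : k) = 0)
    (hBz : ∃ u₁ ∈ N, ∃ h ∈ H, ∃ u₂ ∈ N, b * z * b = u₁ * b * h * u₂)
    {v₀ : W} (hv₀ : v₀ ≠ 0) (hN : ∀ n ∈ N, ρ n v₀ = v₀) :
    ∃ v : W, v ≠ 0 ∧ (∀ n ∈ N, ρ n v = v) ∧ (∀ h ∈ H, ∃ c : k, ρ h v = c • v) ∧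
      ∀ n ∈ N, ρ n (ρ b v) ∈ Submodule.span k {w | ∃ n ∈ N, w = ρ (b * n * b) v} := by
  have : Fintype N := Fintype.ofFinite N
  have hbb : ∀ w, ρ b (ρ b w) = w := fun w => by
    rw [← Module.End.mul_apply, ← map_mul, hb, map_one, Module.End.one_apply]
  have hmul : ∀ g g' w, ρ (g * g') w = ρ g (ρ g' w) := fun g g' w => by
    rw [map_mul, Module.End.mul_apply]
  let E : W →ₗ[k] W := ∑ n : N, ρ n
  have hE : ∀ w, E w = ∑ n : N, ρ n w := fun w => by simp [E]
  have hE_left : ∀ m ∈ N, ∀ w, ρ m (E w) = E w := fun m hm w => by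
    rw [hE, map_sum]
    refine Fintype.sum_equiv (Equiv.mulLeft (⟨m, hm⟩ : N)) _ _ fun n => ?_
    simp
  have hE_right : ∀ m ∈ N, ∀ w, E (ρ m w) = E w := fun m hm w => by
    rw [hE, hE]
    refine Fintype.sum_equiv (Equiv.mulRight (⟨m, hm⟩ : N)) _ _ fun n => ?_
    simp
  have hE_conj : ∀ h ∈ H, ∀ w, E (ρ h w) = ρ h (E w) := fun h hh w => by
    rw [hE, hE, map_sum]
    symm
    refine Fintype.sum_bijective (fun n : N => (⟨h * n * h⁻¹, hHN h hh n n.2⟩ : N))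
      (Finite.injective_iff_bijective.1 fun n m hnm => ?_) _ _ fun n => ?_
    · exact Subtype.ext (by simpa using congrArg Subtype.val hnm)
    · rw [← hmul, ← hmul, inv_mul_cancel_right]
  let V : Submodule k W := invariantsOn k ρ N
  have hV : ∀ v, v ∈ V ↔ ∀ n ∈ N, ρ n v = v := fun v => Iff.rfl
  have hVH : ∀ h ∈ H, ∀ v ∈ V, ρ h v ∈ V := fun h hh v hv => by
    rw [hV] at hv ⊢
    intro n hn
    have := hv _ (hHN h⁻¹ (H.inv_mem hh) n hn)
    rw [← hmul, show n * h = h * (h⁻¹ * n * h⁻¹⁻¹) by group, hmul, this]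
  have hspan : ∀ v ∈ V, (∀ h ∈ H, ∃ c : k, ρ h v = c • v) → ∀ n ∈ N, n ≠ 1 →
      ρ n (ρ b v) ∈ Submodule.span k {w | ∃ n ∈ N, w = ρ (b * n * b) v} := by
    intro v hv hev n hn hn1
    obtain ⟨u₁, hu₁, h, hh, u₂, hu₂, e⟩ := hBr n hn hn1
    obtain ⟨c, hc⟩ := hev h hh
    have : n * b = b * u₁ * b * h * u₂ := by
      calc n * b = b * b * n * b := by rw [hb, one_mul]
        _ = b * (b * n * b) := by group
        _ = _ := by rw [e]; group
    rw [← hmul, this, hmul, (hV v).1 hv _ hu₂, hmul, hc, map_smul]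
    exact Submodule.smul_mem _ _ (Submodule.subset_span ⟨_, hu₁, rfl⟩)
  suffices hs : ∃ v ∈ V, v ≠ 0 ∧ (∀ h ∈ H, ∃ c : k, ρ h v = c • v) ∧
      ρ b v ∈ Submodule.span k {w | ∃ n ∈ N, w = ρ (b * n * b) v} by
    obtain ⟨v, hv, hv0, hev, hbv⟩ := hs
    refine ⟨v, hv0, (hV v).1 hv, hev, fun n hn => ?_⟩
    by_cases hn1 : n = 1
    · rwa [hn1, map_one, Module.End.one_apply]
    · exact hspan v hv hev n hn hn1
  let L : Submodule k W := V ⊓ LinearMap.ker (E * ρ b)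
  have hL : ∀ v, v ∈ L ↔ v ∈ V ∧ E (ρ b v) = 0 := fun v => by simp [L]
  by_cases hLb : L = ⊥
  · have hVb : V ≠ ⊥ := (Submodule.ne_bot_iff _).2 ⟨v₀, (hV _).2 hN, hv₀⟩
    obtain ⟨v, hv, hv0, hev⟩ := exists_common_eigenvector ρ hH V hVb hVH
    refine ⟨v, hv, hv0, hev, ?_⟩
    by_cases hz1 : z = 1
    · obtain ⟨u₁, hu₁, h, hh, u₂, hu₂, e⟩ := hBz
      obtain ⟨c, hc⟩ := hev h hh
      rw [hz1, mul_one, hb] at e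
      have h1 : c • ρ b v = v := by
        have h2 : ρ u₁ (c • ρ b v) = v := by
          rw [← map_smul, ← hc]
          conv_lhs => rw [← (hV v).1 hv _ hu₂]
          rw [← hmul, ← hmul, ← hmul, ← e,
            map_one, Module.End.one_apply]
        rw [← (hV v).1 hv _ (N.inv_mem hu₁)]
        conv_rhs => rw [← h2, ← hmul, inv_mul_cancel, map_one, Module.End.one_apply]
        rw [(hV v).1 hv _ (N.inv_mem hu₁)]
      have hc0 : c ≠ 0 := by
        rintro rfl
        exact hv0 (by rw [← h1, zero_smul])
      rw [show ρ b v = c⁻¹ • v by rw [eq_inv_smul_iff₀ hc0, h1]]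
      exact Submodule.smul_mem _ _ (Submodule.subset_span ⟨1, N.one_mem, by simp [hb]⟩)
    · have h1 : ∀ n : N, ∃ c : k, E (ρ b (ρ n (ρ b v))) = c • E (ρ b v) := by
        intro n
        by_cases hn1 : (n : Γ) = 1
        · refine ⟨0, ?_⟩
          rw [hn1, map_one, Module.End.one_apply, hbb, hE, zero_smul,
            Finset.sum_congr rfl fun (n : N) _ => (hV v).1 hv n n.2, Finset.sum_const, Finset.card_univ,
            ← Nat.card_eq_fintype_card, ← Nat.cast_smul_eq_nsmul k, hz hz1, zero_smul]
        · obtain ⟨u₁, hu₁, h, hh, u₂, hu₂, e⟩ := hBr n n.2 hn1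
          obtain ⟨c, hc⟩ := hev h hh
          refine ⟨c, ?_⟩
          rw [← hmul, ← hmul, e, hmul, (hV v).1 hv _ hu₂, hmul, hc, map_smul,
            map_smul, hmul, hE_right _ hu₁]
      choose χ hχ using h1
      have h2 : E (ρ b v) - (∑ n, χ n) • v ∈ L := by
        refine (hL _).2 ⟨V.sub_mem ((hV _).2 fun n hn => hE_left n hn _) (V.smul_mem _ hv), ?_⟩
        rw [map_sub, map_sub, map_smul, map_smul, hE (ρ b v), map_sum, map_sum, Finset.sum_smul,
          ← hE, Finset.sum_congr rfl fun n _ => hχ n, sub_self]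
      rw [hLb, Submodule.mem_bot, sub_eq_zero] at h2
      have hc0 : ∑ n, χ n ≠ 0 := by
        intro h0
        rw [h0, zero_smul] at h2
        have : v ∈ L := (hL v).2 ⟨hv, h2⟩
        rw [hLb] at this
        exact hv0 this
      have h3 : ρ b v = (∑ n, χ n)⁻¹ • ∑ n : N, ρ (b * n * b) v := by
        rw [eq_inv_smul_iff₀ hc0, ← map_smul, ← h2, hE, map_sum]
        exact Finset.sum_congr rfl fun n _ => by rw [hmul, hmul]
      rw [h3]
      exact Submodule.smul_mem _ _ (Submodule.sum_mem _ fun n _ =>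
        Submodule.subset_span ⟨n, n.2, rfl⟩)
  · obtain ⟨v, hv, hv0, hev⟩ := exists_common_eigenvector ρ hH L hLb (by
      intro h hh v hv
      rw [hL] at hv ⊢
      refine ⟨hVH h hh v hv.1, ?_⟩
      have : b * h = b * h * b * b := by rw [mul_assoc _ b b, hb, mul_one]
      rw [← hmul, this, hmul, hE_conj _ (hbH h hh), hv.2, map_zero])
    rw [hL] at hv
    refine ⟨v, hv.1, hv0, hev, ?_⟩
    have h0 := hv.2
    rw [hE, ← Finset.add_sum_erase _ _ (Finset.mem_univ 1), add_eq_zero_iff_eq_neg] at h0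
    simp only [OneMemClass.coe_one, map_one, Module.End.one_apply] at h0
    rw [h0]
    refine Submodule.neg_mem _ (Submodule.sum_mem _ fun n hn => ?_)
    exact hspan v hv.1 hev n n.2 fun h => Finset.ne_of_mem_erase hn (Subtype.ext h)

end Abstract

end U21

namespace U21

namespace Setting

variable {S : Setting}

lemma natCast_p_mem : (S.p : S.E) ∈ S.pE 1 := by
  by_contra hp
  have hinv : (S.p : S.E)⁻¹ ∈ S.O := mem_pE_zero.1 (inv_mem_pE hp (by norm_num))
  have hcard : ((S.p ^ (S.fdeg * 2) : ℕ) : S.kE) = 0 := by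
    rw [pow_mul, ← S.hq, ← S.card_res]
    exact Nat.cast_card_eq_zero S.kE
  have hmem : ((S.p ^ (S.fdeg * 2) : ℕ) : S.O) ∈ S.mI := by
    rw [← Ideal.Quotient.eq_zero_iff_mem, map_natCast, hcard]
  obtain ⟨y, hy, e⟩ := (S.hmI _).1 hmem
  have hpw : (S.p : S.E) ^ (S.fdeg * 2) ∈ S.pE 1 := ⟨y, hy, by simpa using e⟩
  have h0 : (S.p : S.E) ≠ 0 := fun h => hp (h ▸ zero_mem_pE 1)
  refine one_notMem_pE_one (S := S) ?_
  have := pE_mul hpw (mem_pE_zero.2 (S.O.pow_mem hinv (S.fdeg * 2))) (by omega : 1 ≤ (1 : ℤ) + 0)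
  rwa [inv_pow, mul_inv_cancel₀ (pow_ne_zero _ h0)] at this

lemma exists_skew_unit : ∃ ε : S.E, ε ∈ S.pE 0 ∧ ε ∉ S.pE 1 ∧ ε + S.conj ε = 0 := by
  obtain ⟨x, hx⟩ : ∃ x, S.conj x ≠ x := by
    by_contra! h
    exact S.conj_ne (RingHom.ext h)
  obtain ⟨n, u, hu⟩ := S.disc (x - S.conj x) (sub_ne_zero.2 hx.symm)
  have hw := zpow_ne_zero n S.unif_ne
  refine ⟨(u : S.O), mem_pE_zero.2 u.1.2, fun h => one_notMem_pE_one (S := S) ?_, ?_⟩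
  · have := pE_mul h (mem_pE_zero.2 (u⁻¹).1.2) (by omega : 1 ≤ (1 : ℤ) + 0)
    rwa [← Subring.coe_mul, Units.mul_inv, Subring.coe_one] at this
  · have h1 : ((u : S.O) : S.E) = (x - S.conj x) * (S.ϖ ^ n)⁻¹ := by
      rw [hu, mul_inv_cancel_right₀ hw]
    rw [h1, map_mul, map_inv₀, map_zpow₀, S.unif_conj, map_sub, S.conj_invol]
    ring

lemma mat_pow_of_eq_nM_zero {z : S.GG} {y : S.E} (hz : S.mat z = S.nM 0 y) (k : ℕ) :
    S.mat (z ^ k) = S.nM 0 (k * y) := by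
  induction k with
  | zero =>
    ext i j
    fin_cases i <;> fin_cases j <;> simp [nM, mat_one]
  | succ k ih =>
    ext i j
    rw [pow_succ, mat_mul_apply, ih, hz]
    fin_cases i <;> fin_cases j <;> simp [nM]
    ring

/-- Some element of `N_k` outside `N_{k+1}` has its `p`-th power in `N_{k+1}`. -/
lemma exists_pow_p_mem_Nk (k : ℤ) :
    ∃ z ∈ S.NkSub k, z ∉ S.NkSub (k + 1) ∧ z ^ S.p ∈ S.NkSub (k + 1) := by
  obtain ⟨ε, hε, hε1, hs⟩ := exists_skew_unit (S := S)
  obtain ⟨z, hz, hm⟩ := exists_mem_Nk (S := S) (k := k) (x := 0) (y := S.ϖ ^ k * ε) (by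
      simp only [map_mul, map_zpow₀, S.unif_conj, zero_mul]
      linear_combination S.ϖ ^ k * hs) (pE_mul (zpow_mem_pE k) hε (by omega))
  refine ⟨z, hz, ?_, ?_⟩
  · rw [mem_NkSub, mem_Nk_iff, hm]
    rintro ⟨-, -, -, -, -, -, h⟩
    apply hε1
    have := pE_mul (zpow_mem_pE (-k)) h (by omega : 1 ≤ -k + (k + 1))
    simpa [nM, zpow_neg, inv_mul_cancel_left₀ (zpow_ne_zero k S.unif_ne)] using this
  · rw [mem_NkSub, mem_Nk_iff, mat_pow_of_eq_nM_zero hm]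
    have := pE_mul natCast_p_mem (pE_mul (zpow_mem_pE k) hε le_rfl) (by omega : k + 1 ≤ _)
    simpa [nM] using this

end Setting

open Setting

namespace Chamber

variable {S : Setting} (C : Chamber S)

lemma bruhat_decomp {u : S.GG} (hu : u ∈ S.NkSub C.nK) (hu1 : u ∉ S.NkSub (C.nK + 1)) :
    ∃ u₁ ∈ S.NkSub C.nK, ∃ h ∈ C.H0Sub, ∃ u₂ ∈ S.NkSub C.nK,
      C.βK * u * C.βK = u₁ * C.βK * h * u₂ := by
  refine C.bigcell_decomp (C.K.mul_mem (C.K.mul_mem C.βK_mem (C.Nk_le_K hu)) C.βK_mem) fun h => ?_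
  obtain ⟨x, y, hxy, hy, hm⟩ := hu
  refine hu1 ⟨x, y, hxy, ?_, hm⟩
  rw [C.mat_βK_conj hm] at h
  have := pE_mul (pE_mul (zpow_mem_pE C.nK) h le_rfl) (zpow_mem_pE C.nK)
    (by omega : C.nK + 1 ≤ C.nK + (1 - C.nK) + C.nK)
  convert this using 1
  have hw := zpow_ne_zero C.nK S.unif_ne
  simp [zpow_neg]
  field_simp

end Chamber

section Weight

variable {S : Setting} {C : Chamber S} {𝔽 : Type} [Field 𝔽] {W : Type} [AddCommGroup W]
  [Module 𝔽 W] {σ : Representation 𝔽 ↥C.K W}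

lemma sigma'_of_mem {g : S.GG} (hg : g ∈ C.K) : sigma' C 𝔽 W σ g = σ ⟨g, hg⟩ := by
  rw [sigma', dif_pos hg]

lemma sigma'_mul {g h : S.GG} (hg : g ∈ C.K) (hh : h ∈ C.K) (w : W) :
    sigma' C 𝔽 W σ (g * h) w = sigma' C 𝔽 W σ g (sigma' C 𝔽 W σ h w) := by
  rw [sigma'_of_mem hg, sigma'_of_mem hh, sigma'_of_mem (C.K.mul_mem hg hh),
    ← Module.End.mul_apply, ← map_mul]
  rfl

lemma sigma'_one : sigma' C 𝔽 W σ 1 = 1 := by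
  rw [sigma'_of_mem C.K.one_mem]
  exact map_one σ

lemma sigma'_inv_apply {g : S.GG} (hg : g ∈ C.K) {w w' : W} (h : sigma' C 𝔽 W σ g w = w') :
    sigma' C 𝔽 W σ g⁻¹ w' = w := by
  rw [← h, ← sigma'_mul (C.K.inv_mem hg) hg, inv_mul_cancel, sigma'_one, Module.End.one_apply]

lemma IsWeight.sigma'_Kone (hσ : IsWeight C 𝔽 W σ) {g : S.GG} (hg : g ∈ C.K)
    (hg1 : g ∈ C.KoneS) (w : W) : sigma' C 𝔽 W σ g w = w := by
  rw [sigma'_of_mem hg, hσ.2.2.2 g hg hg1, LinearMap.id_apply]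

lemma IsWeight.sigma'_Nk (hσ : IsWeight C 𝔽 W σ) {g : S.GG} (hg : g ∈ S.NkSub (C.nK + 1))
    (w : W) : sigma' C 𝔽 W σ g w = w :=
  hσ.sigma'_Kone (C.Nk_le_K (Nk_anti (by omega) hg)) (C.Nk_le_Kone hg) w

lemma IsWeight.sigma'_βK_conj (hσ : IsWeight C 𝔽 W σ) {g : S.GG}
    (hg : g ∈ S.NkSub (C.nK + 1)) (w : W) : sigma' C 𝔽 W σ (C.βK * g * C.βK) w = w := by
  have hK := C.Nk_le_K (Nk_anti (by omega) hg)
  rw [sigma'_mul (C.K.mul_mem C.βK_mem hK) C.βK_mem, sigma'_mul C.βK_mem hK, hσ.sigma'_Nk hg,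
    ← sigma'_mul C.βK_mem C.βK_mem, C.βK_mul_self, sigma'_one, Module.End.one_apply]

lemma IsWeight.sigma'_I1 (hσ : IsWeight C 𝔽 W σ) {v : W}
    (hv : ∀ n ∈ S.NkSub C.nK, sigma' C 𝔽 W σ n v = v) {g : S.GG} (hg : g ∈ C.I1) :
    sigma' C 𝔽 W σ g v = v := by
  obtain ⟨m, hm, h, hh, u, hu, e, h1⟩ := C.iwahori_decomp ((C.mem_I1_iff).1 hg).1
  have hmK : C.βK * m * C.βK ∈ C.K :=
    C.K.mul_mem (C.K.mul_mem C.βK_mem (C.Nk_le_K (Nk_anti (by omega) hm))) C.βK_mem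
  rw [e, sigma'_mul (C.K.mul_mem hmK hh.2) (C.Nk_le_K hu), hv u hu, sigma'_mul hmK hh.2,
    hσ.sigma'_Kone hh.2 (h1 hg), hσ.sigma'_βK_conj hm]

/-- A weight is spanned by the orbit of an `I_{1,K}`-invariant vector under the opposite unipotent
subgroup. -/
lemma IsWeight.exists_span_opposite_eq_top [IsAlgClosed 𝔽] [Algebra (ZMod S.p) 𝔽]
    (hσ : IsWeight C 𝔽 W σ) {v₀ : W} (hv₀ : v₀ ≠ 0)
    (hfix : ∀ n ∈ S.NkSub C.nK, sigma' C 𝔽 W σ n v₀ = v₀) :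
    ∃ v : W, v ≠ 0 ∧ (∀ n ∈ S.NkSub C.nK, sigma' C 𝔽 W σ n v = v) ∧
      Submodule.span 𝔽 {w | ∃ n ∈ S.NkSub C.nK, w = sigma' C 𝔽 W σ (C.βK * n * C.βK) v} = ⊤ := by
  have : FiniteDimensional 𝔽 W := hσ.2.1
  let φ : ↥C.K →* (Module.End 𝔽 W)ˣ := σ.toHomUnits
  let ρ : Representation 𝔽 (Module.End 𝔽 W)ˣ W := Units.coeHom _
  let N := ((S.NkSub C.nK).subgroupOf C.K).map φ
  let H := (C.H0Sub.subgroupOf C.K).map φ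
  have hρ : ∀ (g : S.GG) (hg : g ∈ C.K), ρ (φ ⟨g, hg⟩) = sigma' C 𝔽 W σ g := fun g hg => by
    rw [sigma'_of_mem hg]
    rfl
  have hφ1 : ∀ (g : S.GG) (hg : g ∈ C.K), g ∈ S.NkSub (C.nK + 1) → φ ⟨g, hg⟩ = 1 :=
    fun g hg h => Units.ext (LinearMap.ext fun w => by
      have := hσ.sigma'_Nk h w
      rwa [← hρ g hg] at this)
  have hNmem : ∀ {g : S.GG} (hg : g ∈ S.NkSub C.nK), φ ⟨g, C.Nk_le_K hg⟩ ∈ N := fun hg =>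
    Subgroup.mem_map_of_mem φ (Subgroup.mem_subgroupOf.2 hg)
  have hHmem : ∀ {g : S.GG} (hg : g ∈ C.H0Sub), φ ⟨g, hg.2⟩ ∈ H := fun hg =>
    Subgroup.mem_map_of_mem φ (Subgroup.mem_subgroupOf.2 hg)
  have hBr : ∀ {u : S.GG} (hu : u ∈ S.NkSub C.nK), u ∉ S.NkSub (C.nK + 1) →
      ∃ u₁ ∈ N, ∃ h ∈ H, ∃ u₂ ∈ N, φ ⟨C.βK, C.βK_mem⟩ * φ ⟨u, C.Nk_le_K hu⟩ *
        φ ⟨C.βK, C.βK_mem⟩ = u₁ * φ ⟨C.βK, C.βK_mem⟩ * h * u₂ := by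
    intro u hu hu1
    obtain ⟨u₁, hu₁, h, hh, u₂, hu₂, e⟩ := C.bruhat_decomp hu hu1
    refine ⟨_, hNmem hu₁, _, hHmem hh, _, hNmem hu₂, ?_⟩
    simp only [← map_mul]
    exact congrArg φ (Subtype.ext e)
  have hfin : Finite N := by
    obtain ⟨U, hU, hU'⟩ := exists_reps_Nk (S := S) (k := C.nK)
      (by rcases C.nK_cases with h | h <;> omega) (by rcases C.nK_cases with h | h <;> omega)
    refine Set.Finite.subset ((U.finite_toSet).image
      fun g => if hg : g ∈ C.K then φ ⟨g, hg⟩ else 1) ?_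
    rintro _ ⟨⟨g, hg⟩, hgN, rfl⟩
    have hgN : g ∈ S.NkSub C.nK := hgN
    obtain ⟨u, ⟨hu, hgu⟩, -⟩ := hU' g hgN
    have huK := C.Nk_le_K (hU hu)
    refine ⟨u, hu, ?_⟩
    simp only [huK, dite_true]
    have := hφ1 _ (C.K.mul_mem (C.K.inv_mem hg) huK) hgu
    rw [← mul_right_inj (φ ⟨g, hg⟩)⁻¹, inv_mul_cancel, ← map_inv, ← map_mul]
    exact this
  obtain ⟨z, hz, hz1, hzp⟩ := exists_pow_p_mem_Nk (S := S) C.nK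
  obtain ⟨v, hv0, hvN, hvH, hvs⟩ := exists_eigenvector_mem_span_opposite (k := 𝔽) ρ
    (N := N) (H := H) (b := φ ⟨C.βK, C.βK_mem⟩) (z := φ ⟨z, C.Nk_le_K hz⟩)
    (by
      rw [← map_mul, ← map_one φ]
      exact congrArg φ (Subtype.ext C.βK_mul_self))
    (by
      rintro _ ⟨h, hh, rfl⟩ _ ⟨h', hh', rfl⟩
      rw [← map_mul, ← map_mul]
      exact congrArg φ (Subtype.ext (Chamber.Hset_comm hh.1 hh'.1)))
    (by
      rintro _ ⟨h, hh, rfl⟩ _ ⟨n, hn, rfl⟩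
      rw [← map_inv, ← map_mul, ← map_mul]
      exact hNmem (C.H0_conj_mem_Nk hh hn))
    (by
      rintro _ ⟨h, hh, rfl⟩
      rw [← map_mul, ← map_mul]
      exact hHmem (C.βK_conj_mem_H0 hh))
    (by
      rintro _ ⟨⟨u, huK⟩, hu, rfl⟩ hu1
      exact hBr hu fun h => hu1 (hφ1 _ _ h))
    (by
      intro hz'
      have hord : orderOf (φ ⟨z, C.Nk_le_K hz⟩) = S.p := by
        have : Fact S.p.Prime := ⟨S.hp⟩
        refine orderOf_eq_prime ?_ hz'
        rw [← map_pow]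
        exact hφ1 _ (C.K.pow_mem (C.Nk_le_K hz) _) hzp
      obtain ⟨d, hd⟩ := hord ▸ Subgroup.orderOf_dvd_natCard N (hNmem hz)
      have hp0 : (S.p : 𝔽) = 0 := by
        rw [← map_natCast (algebraMap (ZMod S.p) 𝔽), ZMod.natCast_self, map_zero]
      rw [hd, Nat.cast_mul, hp0, zero_mul])
    (hBr hz hz1) hv₀
    (by
      rintro _ ⟨⟨n, hnK⟩, hn, rfl⟩
      rw [hρ]
      exact hfix n hn)
  refine ⟨v, hv0, fun n hn => ?_, ?_⟩
  · rw [← hρ n (C.Nk_le_K hn)]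
    exact hvN _ (hNmem hn)
  set Y := Submodule.span 𝔽 {w | ∃ n ∈ S.NkSub C.nK, w = sigma' C 𝔽 W σ (C.βK * n * C.βK) v}
    with hY
  have hYeq : Submodule.span 𝔽 {w | ∃ n ∈ N, w = ρ (φ ⟨C.βK, C.βK_mem⟩ * n *
      φ ⟨C.βK, C.βK_mem⟩) v} ≤ Y := by
    refine Submodule.span_mono ?_
    rintro _ ⟨_, ⟨⟨n, hnK⟩, hn, rfl⟩, rfl⟩
    refine ⟨n, hn, ?_⟩
    rw [← map_mul, ← map_mul, ← hρ _ (C.K.mul_mem (C.K.mul_mem C.βK_mem hnK) C.βK_mem)]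
    rfl
  have hvY : v ∈ Y := Submodule.subset_span ⟨1, Subgroup.one_mem _, by
    rw [mul_one, C.βK_mul_self, sigma'_one, Module.End.one_apply]⟩
  have hvN' : ∀ n ∈ S.NkSub C.nK, sigma' C 𝔽 W σ n v = v := fun n hn => by
    rw [← hρ n (C.Nk_le_K hn)]
    exact hvN _ (hNmem hn)
  have hvH' : ∀ h ∈ C.H0Sub, ∃ c : 𝔽, sigma' C 𝔽 W σ h v = c • v := fun h hh => by
    rw [← hρ h hh.2]
    exact hvH _ (hHmem hh)
  have horb : ∀ g ∈ C.K, sigma' C 𝔽 W σ g v ∈ Y := by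
    intro g hg
    by_cases hc : S.mat g 2 0 ∈ S.pE (1 - C.nK)
    · obtain ⟨m, hm, h, hh, u, hu, rfl, -⟩ := C.iwahori_decomp (C.mem_IK_of_corner hg hc)
      obtain ⟨c, hc⟩ := hvH' h hh
      have hmK : C.βK * m * C.βK ∈ C.K :=
        C.K.mul_mem (C.K.mul_mem C.βK_mem (C.Nk_le_K (Nk_anti (by omega) hm))) C.βK_mem
      rw [sigma'_mul (C.K.mul_mem hmK hh.2) (C.Nk_le_K hu), hvN' u hu, sigma'_mul hmK hh.2,
        hσ.sigma'_βK_conj hm, hc]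
      exact Y.smul_mem _ hvY
    · obtain ⟨u₁, hu₁, h, hh, u₂, hu₂, rfl⟩ := C.bigcell_decomp hg hc
      obtain ⟨c, hc⟩ := hvH' h hh
      have huK := C.Nk_le_K hu₁
      rw [sigma'_mul (C.K.mul_mem (C.K.mul_mem huK C.βK_mem) hh.2) (C.Nk_le_K hu₂), hvN' _ hu₂,
        sigma'_mul (C.K.mul_mem huK C.βK_mem) hh.2, hc, map_smul, sigma'_mul huK C.βK_mem,
        ← hρ _ huK, ← hρ _ C.βK_mem]
      exact Y.smul_mem _ (hYeq (hvs _ (hNmem hu₁)))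
  have hO : Submodule.span 𝔽 {w | ∃ g ∈ C.K, w = sigma' C 𝔽 W σ g v} = ⊤ := by
    refine (hσ.2.2.1 _ ?_).resolve_left ?_
    · intro k w hw
      induction hw using Submodule.span_induction with
      | mem x hx =>
        obtain ⟨g, hg, rfl⟩ := hx
        refine Submodule.subset_span ⟨k * g, C.K.mul_mem k.2 hg, ?_⟩
        rw [sigma'_mul k.2 hg, sigma'_of_mem k.2]
      | zero => simp
      | add x y _ _ hx hy =>
        rw [map_add]
        exact Submodule.add_mem _ hx hy
      | smul a x _ hx =>
        rw [map_smul]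
        exact Submodule.smul_mem _ _ hx
    · refine (Submodule.ne_bot_iff _).2 ⟨v, Submodule.subset_span ⟨1, C.K.one_mem, ?_⟩, hv0⟩
      rw [sigma'_one, Module.End.one_apply]
  rw [eq_top_iff, ← hO, Submodule.span_le]
  rintro _ ⟨g, hg, rfl⟩
  exact horb g hg

/-- `j_σ` takes values in the line `σ^{I_{1,K}}`. -/
lemma IsWeight.j_apply_mem_span [IsAlgClosed 𝔽] [Algebra (ZMod S.p) 𝔽] (hσ : IsWeight C 𝔽 W σ)
    {jσ : W →ₗ[𝔽] W} (hj : IsJ C 𝔽 W σ jσ) {v₀ : W} (hv₀ : v₀ ≠ 0)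
    (hfix : ∀ g ∈ C.I1, sigma' C 𝔽 W σ g v₀ = v₀) (w : W) : ∃ c : 𝔽, jσ w = c • v₀ := by
  obtain ⟨v, hv0, hvN, hspan⟩ := hσ.exists_span_opposite_eq_top hv₀
    fun n hn => hfix n (C.Nk_le_I1 hn)
  have hjv : jσ v = v := hj.1 v fun g hg => hσ.sigma'_I1 hvN hg
  have hrange : ∀ w, jσ w ∈ Submodule.span 𝔽 {v} := by
    intro w
    have hw : w ∈ Submodule.span 𝔽
        {w | ∃ n ∈ S.NkSub C.nK, w = sigma' C 𝔽 W σ (C.βK * n * C.βK) v} := hspan ▸ trivial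
    refine (Submodule.span_le (p := (Submodule.span 𝔽 {v}).comap jσ)).2 ?_ hw
    rintro _ ⟨n, hn, rfl⟩
    have := hj.2 v _ (C.βK_conj_mem_I1' hn)
    rw [map_sub, sub_eq_zero, hjv] at this
    show jσ (sigma' C 𝔽 W σ (C.βK * n * C.βK) v) ∈ Submodule.span 𝔽 {v}
    rw [this]
    exact Submodule.mem_span_singleton_self v
  obtain ⟨a, ha⟩ := Submodule.mem_span_singleton.1 (hj.1 v₀ hfix ▸ hrange v₀)
  obtain ⟨b, hb⟩ := Submodule.mem_span_singleton.1 (hrange w)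
  have ha0 : a ≠ 0 := by
    rintro rfl
    exact hv₀ (by rw [← ha, zero_smul])
  refine ⟨b * a⁻¹, ?_⟩
  rw [← hb, ← ha, smul_smul, inv_mul_cancel_right₀ ha0]

end Weight

end U21

namespace U21

namespace Setting

variable {S : Setting}

lemma IsReps.mul {A B D : Subgroup S.GG} (hAB : B ≤ A) (hBD : D ≤ B) {U V : Finset S.GG}
    (hU : S.IsReps A B U) (hV : S.IsReps B D V) :
    Set.InjOn (fun z : S.GG × S.GG => z.1 * z.2) ↑(U ×ˢ V) ∧
      S.IsReps A D ((U ×ˢ V).image fun z => z.1 * z.2) := by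
  have huniq : ∀ a ∈ A, ∀ u ∈ U, ∀ u' ∈ U, a⁻¹ * u ∈ B → a⁻¹ * u' ∈ B → u = u' :=
    fun a ha u hu u' hu' h h' => (hU.2 a ha).unique ⟨hu, h⟩ ⟨hu', h'⟩
  refine ⟨?_, ?_, ?_⟩
  · rintro ⟨u, v⟩ huv ⟨u', v'⟩ huv' e
    simp only [Finset.coe_product, Set.mem_prod, Finset.mem_coe] at huv huv' e
    have huA := hU.1 huv.1
    have hvB := hV.1 huv.2
    have hvB' := hV.1 huv'.2
    obtain rfl : u = u' := by
      refine huniq _ (A.mul_mem huA (hAB hvB)) u huv.1 u' huv'.1 ?_ ?_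
      · simpa [mul_assoc] using B.inv_mem hvB
      · rw [e]
        simpa [mul_assoc] using B.inv_mem hvB'
    rw [mul_left_cancel e]
  · intro x hx
    obtain ⟨⟨u, v⟩, huv, rfl⟩ := Finset.mem_image.1 hx
    rw [Finset.mem_product] at huv
    exact A.mul_mem (hU.1 huv.1) (hAB (hV.1 huv.2))
  · intro a ha
    obtain ⟨u, ⟨hu, hau⟩, -⟩ := hU.2 a ha
    have hb : u⁻¹ * a ∈ B := by simpa using B.inv_mem hau
    obtain ⟨v, ⟨hv, hbv⟩, hv'⟩ := hV.2 _ hb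
    refine ⟨u * v, ⟨Finset.mem_image.2 ⟨(u, v), Finset.mem_product.2 ⟨hu, hv⟩, rfl⟩, ?_⟩, ?_⟩
    · simpa [mul_assoc] using hbv
    · rintro x ⟨hx, hax⟩
      obtain ⟨⟨u', v'⟩, huv, rfl⟩ := Finset.mem_image.1 hx
      rw [Finset.mem_product] at huv
      have hvB' := hV.1 huv.2
      obtain rfl : u = u' := by
        refine huniq a ha u hu u' huv.1 hau ?_
        have := B.mul_mem (hBD hax) (B.inv_mem hvB')
        simpa [mul_assoc] using this
      have : v' = v := hv' v' ⟨huv.2, by simpa [mul_assoc] using hax⟩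
      exact congrArg _ this

end Setting

namespace Chamber

variable {S : Setting} {C : Chamber S}

lemma mem_Nk_of_mem_K {z : S.GG} {k : ℤ} (hz : z ∈ S.NkSub k) (hK : z ∈ C.K) :
    z ∈ S.NkSub C.nK := by
  obtain ⟨x, y, h, -, hm⟩ := hz
  have h02 := (C.mem_K_iff.1 hK).1.2.2
  rw [hm] at h02
  exact ⟨x, y, h, by simpa [Setting.nM] using h02, hm⟩

end Chamber

section CompactInduction

variable {S : Setting} {C : Chamber S} {𝔽 : Type} [Field 𝔽]
variable {W : Type} [AddCommGroup W] [Module 𝔽 W] {σ : Representation 𝔽 ↥C.K W}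

lemma stdFn_apply_of_mem {g x : S.GG} (h : x * g ∈ C.K) (v : W) :
    stdFn C 𝔽 W σ g v x = sigma' C 𝔽 W σ (x * g) v := by
  rw [stdFn, dif_pos h, sigma'_of_mem h]

lemma stdFn_apply_of_notMem {g x : S.GG} (h : x * g ∉ C.K) (v : W) :
    stdFn C 𝔽 W σ g v x = 0 := dif_neg h

lemma stdFn_mem (g : S.GG) (v : W) : stdFn C 𝔽 W σ g v ∈ IndSub C 𝔽 W σ := by
  refine ⟨fun k hk x => ?_, {g⁻¹}, fun x hx => ?_⟩
  · by_cases h : x * g ∈ C.K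
    · have h' : k * x * g ∈ C.K := by
        rw [mul_assoc]
        exact C.K.mul_mem hk h
      rw [stdFn_apply_of_mem h, stdFn_apply_of_mem h', mul_assoc, sigma'_mul hk h,
        sigma'_of_mem hk]
    · have h' : k * x * g ∉ C.K := by
        rwa [mul_assoc, C.K.mul_mem_cancel_left hk]
      rw [stdFn_apply_of_notMem h, stdFn_apply_of_notMem h', map_zero]
  · have h : x * g ∈ C.K := by
      by_contra h
      exact hx (stdFn_apply_of_notMem h v)
    exact ⟨x * g, h, g⁻¹, Finset.mem_singleton_self _, (mul_inv_cancel_right x g).symm⟩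

variable (σ) in
/-- The element `[g, v]` of `ind_K^G σ`, as a linear function of `v`. -/
def stdInd (g : S.GG) : W →ₗ[𝔽] ↥(IndSub C 𝔽 W σ) where
  toFun v := ⟨stdFn C 𝔽 W σ g v, stdFn_mem g v⟩
  map_add' v w := by
    refine Subtype.ext (funext fun x => ?_)
    by_cases h : x * g ∈ C.K
    · simp [stdFn_apply_of_mem h]
    · simp [stdFn_apply_of_notMem h]
  map_smul' c v := by
    refine Subtype.ext (funext fun x => ?_)
    by_cases h : x * g ∈ C.K
    · simp [stdFn_apply_of_mem h]
    · simp [stdFn_apply_of_notMem h]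

lemma coe_stdInd (g : S.GG) (v : W) :
    (stdInd σ g v : S.GG → W) = stdFn C 𝔽 W σ g v := rfl

lemma coe_indRep (g x : S.GG) (f : ↥(IndSub C 𝔽 W σ)) :
    (indRep C 𝔽 W σ g f : S.GG → W) x = (f : S.GG → W) (x * g) := rfl

lemma indRep_stdInd (g h : S.GG) (v : W) :
    indRep C 𝔽 W σ g (stdInd σ h v) = stdInd σ (g * h) v := by
  refine Subtype.ext (funext fun x => ?_)
  rw [coe_indRep, coe_stdInd, coe_stdInd, stdFn, stdFn]
  simp only [mul_assoc]

lemma stdInd_mul {g k : S.GG} (hk : k ∈ C.K) (v : W) :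
    stdInd σ (g * k) v = stdInd σ g (sigma' C 𝔽 W σ k v) := by
  refine Subtype.ext (funext fun x => ?_)
  rw [coe_stdInd, coe_stdInd]
  by_cases h : x * g ∈ C.K
  · have h' : x * (g * k) ∈ C.K := by
      rw [← mul_assoc]
      exact C.K.mul_mem h hk
    rw [stdFn_apply_of_mem h, stdFn_apply_of_mem h', ← mul_assoc, sigma'_mul h hk]
  · have h' : x * (g * k) ∉ C.K := by
      rwa [← mul_assoc, C.K.mul_mem_cancel_right hk]
    rw [stdFn_apply_of_notMem h, stdFn_apply_of_notMem h']

lemma ind_apply_mul (f : ↥(IndSub C 𝔽 W σ)) {k : S.GG} (hk : k ∈ C.K) (x : S.GG) :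
    (f : S.GG → W) (k * x) = sigma' C 𝔽 W σ k ((f : S.GG → W) x) := by
  rw [sigma'_of_mem hk]
  exact f.2.1 k hk x

/-- `ind_K^G σ` is spanned by the elements `[g, v]`. -/
lemma eq_top_of_stdInd_mem {M : Submodule 𝔽 ↥(IndSub C 𝔽 W σ)}
    (hM : ∀ g v, stdInd σ g v ∈ M) : M = ⊤ := by
  have key : ∀ (s : Finset S.GG) (f : ↥(IndSub C 𝔽 W σ)),
      (∀ x, (f : S.GG → W) x ≠ 0 → ∃ k ∈ C.K, ∃ t ∈ s, x = k * t) → f ∈ M := by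
    intro s
    induction s using Finset.induction_on with
    | empty =>
      intro f hf
      have : f = 0 := by
        refine Subtype.ext (funext fun x => ?_)
        by_contra hx
        obtain ⟨-, -, t, ht, -⟩ := hf x hx
        exact absurd ht (Finset.notMem_empty t)
      rw [this]
      exact M.zero_mem
    | insert a s _ ih =>
      intro f hf
      have hsub : f - stdInd σ a⁻¹ ((f : S.GG → W) a) ∈ M := by
        refine ih _ fun x hx => ?_
        have hx' : (f : S.GG → W) x - stdFn C 𝔽 W σ a⁻¹ ((f : S.GG → W) a) x ≠ 0 := hx
        by_cases h : x * a⁻¹ ∈ C.K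
        · refine absurd ?_ hx'
          rw [stdFn_apply_of_mem h, ← ind_apply_mul f h, inv_mul_cancel_right, sub_self]
        · rw [stdFn_apply_of_notMem h, sub_zero] at hx'
          obtain ⟨k, hk, t, ht, rfl⟩ := hf x hx'
          obtain rfl | ht := Finset.mem_insert.1 ht
          · exact absurd (by rwa [mul_inv_cancel_right]) h
          · exact ⟨k, hk, t, ht, rfl⟩
      have := M.add_mem hsub (hM a⁻¹ ((f : S.GG → W) a))
      rwa [sub_add_cancel] at this
  rw [eq_top_iff]
  intro f _
  obtain ⟨s, hs⟩ := f.2.2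
  exact key s f hs

/-- For an irreducible weight `σ`, any `[1, v]` with `v ≠ 0` generates `ind_K^G σ`. -/
lemma IsWeight.eq_top_of_invt (hσ : IsWeight C 𝔽 W σ) {M : Submodule 𝔽 ↥(IndSub C 𝔽 W σ)}
    (hM : Invt 𝔽 (indRep C 𝔽 W σ) M) {v : W} (hv : v ≠ 0) (h : stdInd σ 1 v ∈ M) : M = ⊤ := by
  have hW : M.comap (stdInd σ 1) = ⊤ := by
    refine (hσ.2.2.1 _ fun k w hw => ?_).resolve_left fun hbot => hv ?_
    · have := hM k _ hw
      rw [indRep_stdInd, mul_one, ← one_mul (k : S.GG), stdInd_mul k.2, sigma'_of_mem k.2] at this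
      exact this
    · rw [← Submodule.mem_bot 𝔽, ← hbot]
      exact h
  refine eq_top_of_stdInd_mem fun g w => ?_
  have hw : w ∈ M.comap (stdInd σ 1) := hW ▸ Submodule.mem_top
  have := hM g _ hw
  rwa [indRep_stdInd, mul_one] at this

end CompactInduction

end U21

namespace U21

section CompactInduction

open Setting

variable {S : Setting} {C : Chamber S} {𝔽 : Type} [Field 𝔽]
variable {W : Type} [AddCommGroup W] [Module 𝔽 W] {σ : Representation 𝔽 ↥C.K W}

/-- The value at `α⁻¹ i`, for `i` in the pro-`p` Iwahori subgroup, of `[β_K u α⁻¹, v]`, where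
`i⁻¹ = β_K m β_K h u₀` is an Iwahori factorization. -/
lemma IsWeight.stdFn_apply_alphaE_inv_mul (hσ : IsWeight C 𝔽 W σ) {v : W}
    (hv : ∀ g ∈ C.I1, sigma' C 𝔽 W σ g v = v) {m h u₀ u i : S.GG}
    (hm : m ∈ S.NkSub (C.nK + 1)) (hh : h ∈ C.H0Sub) (hh1 : h ∈ C.KoneS)
    (hu₀ : u₀ ∈ S.NkSub C.nK) (hu : u ∈ S.NkSub (C.nK + 1))
    (hi : i⁻¹ = C.βK * m * C.βK * h * u₀) :
    stdFn C 𝔽 W σ (C.βK * u * S.alphaE⁻¹) v (S.alphaE⁻¹ * i) =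
      if m⁻¹ * u ∈ S.NkSub (C.nK + 2) then sigma' C 𝔽 W σ C.βK v else 0 := by
  have hcomm : S.alphaE⁻¹ * h⁻¹ = h⁻¹ * S.alphaE⁻¹ := by
    rw [← mul_inv_rev, ← mul_inv_rev, Chamber.Hset_comm hh.1 Chamber.alphaE_mem_Hset]
  have hβα : S.alphaE⁻¹ * C.βK = C.βK * S.alphaE := by
    rw [← C.βK_alphaE, mul_assoc _ C.βK, C.βK_mul_self, mul_one]
  set n := S.alphaE⁻¹ * u₀⁻¹ * S.alphaE with hn
  have hnN : n ∈ S.NkSub (C.nK + 1) :=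
    Nk_anti (by omega) (conj_alphaE_inv_mem_Nk ((S.NkSub _).inv_mem hu₀))
  have hnK : n ∈ C.K := C.Nk_le_K (Nk_anti (by omega) hnN)
  have hhK : h⁻¹ ∈ C.K := C.K.inv_mem hh.2
  set z := S.alphaE * (m⁻¹ * u) * S.alphaE⁻¹ with hz
  have hfac : S.alphaE⁻¹ * i * (C.βK * u * S.alphaE⁻¹) = n * h⁻¹ * (C.βK * z) := by
    have hi' : i = u₀⁻¹ * h⁻¹ * (C.βK * m⁻¹ * C.βK) := by
      rw [← inv_inv i, hi]
      simp only [mul_inv_rev, C.βK_inv, mul_assoc]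
    calc S.alphaE⁻¹ * i * (C.βK * u * S.alphaE⁻¹)
        = S.alphaE⁻¹ * u₀⁻¹ * h⁻¹ * C.βK * m⁻¹ * (C.βK * C.βK) * u * S.alphaE⁻¹ := by
          rw [hi']
          simp only [mul_assoc]
      _ = n * (S.alphaE⁻¹ * h⁻¹) * C.βK * m⁻¹ * u * S.alphaE⁻¹ := by
          rw [C.βK_mul_self, hn]
          simp only [mul_assoc, mul_inv_cancel_left, one_mul]
      _ = n * h⁻¹ * (S.alphaE⁻¹ * C.βK) * m⁻¹ * u * S.alphaE⁻¹ := by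
          rw [hcomm]
          simp only [mul_assoc]
      _ = n * h⁻¹ * (C.βK * z) := by
          rw [hβα, hz]
          simp only [mul_assoc]
  have hiff : S.alphaE⁻¹ * i * (C.βK * u * S.alphaE⁻¹) ∈ C.K ↔ m⁻¹ * u ∈ S.NkSub (C.nK + 2) := by
    rw [hfac, C.K.mul_mem_cancel_left (C.K.mul_mem hnK hhK), C.K.mul_mem_cancel_left C.βK_mem]
    refine ⟨fun hzK => ?_, fun hmu => C.Nk_le_K (conj_alphaE_mem_Nk hmu)⟩
    have h1 : m⁻¹ * u ∈ S.NkSub (C.nK - 1 + 2) :=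
      Nk_anti (by omega) ((S.NkSub _).mul_mem ((S.NkSub _).inv_mem hm) hu)
    have := conj_alphaE_inv_mem_Nk (Chamber.mem_Nk_of_mem_K (conj_alphaE_mem_Nk h1) hzK)
    simpa [mul_assoc] using this
  split_ifs with hmu
  · have hzN : z ∈ S.NkSub C.nK := conj_alphaE_mem_Nk hmu
    have hzK := C.Nk_le_K hzN
    rw [stdFn_apply_of_mem (hiff.2 hmu), hfac,
      sigma'_mul (C.K.mul_mem hnK hhK) (C.K.mul_mem C.βK_mem hzK), sigma'_mul hnK hhK,
      hσ.sigma'_Nk hnN, sigma'_mul C.βK_mem hzK, hv z (C.Nk_le_I1 hzN)]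
    exact sigma'_inv_apply hh.2 (hσ.sigma'_Kone hh.2 hh1 _)
  · exact stdFn_apply_of_notMem (fun h' => hmu (hiff.1 h')) v

/-- The function `f₁` equals `∑ [β_K u α⁻¹, v₀]`, summed over `u ∈ N_{n_K+1}/N_{n_K+2}`. -/
lemma IsFFamily.eq_sum (hσ : IsWeight C 𝔽 W σ) {v₀ : W} {ff : ℤ → ↥(IndSub C 𝔽 W σ)}
    (hff : IsFFamily C 𝔽 W σ v₀ ff) {U : Finset S.GG}
    (hU : S.IsReps (S.Nk (C.nK + 1)) (S.Nk (C.nK + 2)) U) :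
    ff 1 = ∑ u ∈ U, stdInd σ (C.βK * u * S.alphaE⁻¹) v₀ := by
  obtain ⟨-, hfix, hinv, hsupp, hpos, -⟩ := hff
  have hval : ∀ i ∈ C.I1, (ff 1 : S.GG → W) (S.alphaE⁻¹ * i) =
      (↑(∑ u ∈ U, stdInd σ (C.βK * u * S.alphaE⁻¹) v₀) : S.GG → W) (S.alphaE⁻¹ * i) := by
    intro i hi
    have h1 : (ff 1 : S.GG → W) (S.alphaE⁻¹ * i) = sigma' C 𝔽 W σ C.βK v₀ := by
      rw [← coe_indRep, hinv 1 i hi, ← hpos 1 one_pos, zpow_neg_one]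
    have hi' := C.inv_mem_I1 hi
    obtain ⟨m, hm, h, hh, u₀, hu₀, e, hh1⟩ := C.iwahori_decomp (C.mem_I1_iff.1 hi').1
    obtain ⟨u₁, ⟨hu₁, hmu₁⟩, huniq⟩ := hU.2 m hm
    rw [h1, Submodule.coe_sum, Finset.sum_apply, Finset.sum_eq_single_of_mem u₁ hu₁, coe_stdInd,
      hσ.stdFn_apply_alphaE_inv_mul hfix hm hh (hh1 hi') hu₀ (hU.1 hu₁) e]
    · exact (if_pos hmu₁).symm
    · intro u hu hne
      rw [coe_stdInd, hσ.stdFn_apply_alphaE_inv_mul hfix hm hh (hh1 hi') hu₀ (hU.1 hu) e]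
      exact if_neg fun hmu => hne (huniq u ⟨hu, hmu⟩)
  refine Subtype.ext (funext fun x => ?_)
  by_cases hx : ∃ k ∈ C.K, ∃ i ∈ C.I1, x = k * S.alphaE⁻¹ * i
  · obtain ⟨k, hk, i, hi, rfl⟩ := hx
    rw [mul_assoc, ind_apply_mul _ hk, ind_apply_mul _ hk, hval i hi]
  · have h0 : (ff 1 : S.GG → W) x = 0 := by
      by_contra h
      refine hx ?_
      simpa only [zpow_neg_one] using hsupp 1 x h
    rw [h0, Submodule.coe_sum, Finset.sum_apply, eq_comm]
    refine Finset.sum_eq_zero fun u hu => stdFn_apply_of_notMem (fun hK => hx ?_) v₀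
    have huN : u⁻¹ ∈ S.NkSub (C.nK + 1) := (S.NkSub _).inv_mem (hU.1 hu)
    refine ⟨_, C.K.mul_mem hK C.βK_mem, _, C.βK_conj_mem_I1 huN, ?_⟩
    have hαβ : C.βK * S.alphaE⁻¹ = S.alphaE * C.βK := by
      rw [← C.βK_alphaE, mul_assoc, C.βK_mul_cancel_left]
    calc x = x * C.βK * u * S.alphaE⁻¹ * (S.alphaE * C.βK) * (C.βK * u⁻¹ * C.βK) := by
          simp only [mul_assoc, C.βK_mul_cancel_left, inv_mul_cancel_left, mul_inv_cancel_left,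
            C.βK_mul_self, mul_one]
      _ = _ := by
          rw [← hαβ]
          simp only [mul_assoc]

lemma mem_orbitSpan {V G₀ : Type} [Monoid G₀] [AddCommGroup V] [Module 𝔽 V]
    (ρ : Representation 𝔽 G₀ V) (v : V) : v ∈ orbitSpan 𝔽 ρ v :=
  Submodule.subset_span ⟨1, by rw [map_one, Module.End.one_apply]⟩

lemma invt_orbitSpan {V G₀ : Type} [Monoid G₀] [AddCommGroup V] [Module 𝔽 V]
    (ρ : Representation 𝔽 G₀ V) (v : V) : Invt 𝔽 ρ (orbitSpan 𝔽 ρ v) := by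
  intro g w hw
  refine (Submodule.span_le (p := (orbitSpan 𝔽 ρ v).comap (ρ g))).2 ?_ hw
  rintro _ ⟨h, rfl⟩
  exact Submodule.subset_span ⟨g * h, by rw [map_mul, Module.End.mul_apply]⟩

/-- The image of the Hecke operator `T` is contained in the subrepresentation generated
by `f₁`. -/
lemma IsHeckeT.range_le [IsAlgClosed 𝔽] [Algebra (ZMod S.p) 𝔽] (hσ : IsWeight C 𝔽 W σ)
    {v₀ : W} {ff : ℤ → ↥(IndSub C 𝔽 W σ)} (hff : IsFFamily C 𝔽 W σ v₀ ff)
    {jσ : W →ₗ[𝔽] W} (hj : IsJ C 𝔽 W σ jσ) {T : Module.End 𝔽 ↥(IndSub C 𝔽 W σ)}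
    (hT : IsHeckeT C 𝔽 W σ jσ T) :
    LinearMap.range T ≤ orbitSpan 𝔽 (indRep C 𝔽 W σ) (ff 1) := by
  set M := orbitSpan 𝔽 (indRep C 𝔽 W σ) (ff 1) with hM
  have hMinv : Invt 𝔽 (indRep C 𝔽 W σ) M := invt_orbitSpan _ _
  have hMf : ff 1 ∈ M := mem_orbitSpan _ _
  have hv₀ := hff.1
  have hfix := hff.2.1
  have hn := C.nK_cases
  obtain ⟨U, hU⟩ := exists_reps_Nk (S := S) (k := C.nK) (by omega) (by omega)
  obtain ⟨V, hV⟩ := exists_reps_Nk (S := S) (k := C.nK + 1) (by omega) (by omega)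
  rw [add_assoc, one_add_one_eq_two] at hV
  obtain ⟨hinj, hUV⟩ := IsReps.mul (A := S.NkSub C.nK) (B := S.NkSub (C.nK + 1))
    (D := S.NkSub (C.nK + 2)) (Nk_anti (by omega)) (Nk_anti (by omega)) hU hV
  obtain ⟨c, hc⟩ := hσ.j_apply_mem_span hj hv₀ hfix (sigma' C 𝔽 W σ C.βK v₀)
  have hf1 := hff.eq_sum hσ hV
  have hTv : T (stdInd σ 1 v₀) =
      ∑ u ∈ U, indRep C 𝔽 W σ (u * C.βK) (ff 1) + c • ff 1 := by
    refine Subtype.ext ((hT.2 v₀ _ (coe_stdInd 1 v₀) _ _ hUV hV).trans ?_)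
    rw [Submodule.coe_add, Submodule.coe_sum, Submodule.coe_smul, hf1]
    congr 1
    · rw [Finset.sum_image hinj, Finset.sum_product]
      refine Finset.sum_congr rfl fun u hu => ?_
      rw [map_sum, Submodule.coe_sum]
      refine Finset.sum_congr rfl fun w hw => ?_
      have huw : u * w ∈ S.NkSub C.nK :=
        (S.NkSub _).mul_mem (hU.1 hu) (Nk_anti (by omega) (hV.1 hw))
      rw [indRep_stdInd, coe_stdInd,
        sigma'_inv_apply (C.Nk_le_K huw) (hfix _ (C.Nk_le_I1 huw)), hj.1 v₀ hfix]
      simp only [mul_assoc, C.βK_mul_cancel_left]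
    · rw [Submodule.coe_sum, Finset.smul_sum]
      refine Finset.sum_congr rfl fun w _ => ?_
      rw [hc, ← coe_stdInd, map_smul, Submodule.coe_smul]
  have hcomap : M.comap T = ⊤ := by
    refine hσ.eq_top_of_invt (fun g f hf => ?_) hv₀ ?_
    · rw [Submodule.mem_comap, hT.1]
      exact hMinv g _ hf
    · rw [Submodule.mem_comap, hTv]
      exact M.add_mem (M.sum_mem fun u _ => hMinv _ _ hMf) (M.smul_mem c hMf)
  rwa [LinearMap.range_eq_map, Submodule.map_le_iff_le_comap, top_le_iff]

end CompactInduction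

end U21

namespace U21

/-- If `dim σ > 1` and the image of `f₁` generates `(ind_K^G σ)/(T)`,
then `f₁` generates `ind_K^G σ`. -/
theorem stmt6
    (S : Setting) (C : Chamber S)
    (𝔽 : Type) [Field 𝔽] [IsAlgClosed 𝔽] [Algebra (ZMod S.p) 𝔽]
    [Algebra.IsAlgebraic (ZMod S.p) 𝔽]
    (W : Type) [AddCommGroup W] [Module 𝔽 W]
    (σ : Representation 𝔽 ↥C.K W) (hσ : IsWeight C 𝔽 W σ)
    (hdim : 1 < Module.finrank 𝔽 W)
    (v0 : W) (ff : ℤ → ↥(IndSub C 𝔽 W σ)) (hff : IsFFamily C 𝔽 W σ v0 ff)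
    (jσ : W →ₗ[𝔽] W) (hj : IsJ C 𝔽 W σ jσ)
    (T : Module.End 𝔽 ↥(IndSub C 𝔽 W σ)) (hT : IsHeckeT C 𝔽 W σ jσ T)
    (hgen : orbitSpan 𝔽 (indRep C 𝔽 W σ) (ff 1) ⊔ LinearMap.range T = ⊤) :
    orbitSpan 𝔽 (indRep C 𝔽 W σ) (ff 1) = ⊤ := by
  rwa [sup_eq_left.2 (IsHeckeT.range_le hσ hff hj hT)] at hgen

end U21
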